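/- arXiv:1412.1143 — 2 statements merged into one kernel-verified Lean document; each statement's English description precedes it below -/
import Mathlib

section
/- Let μ be a homogeneous strongly Rayleigh probability distribution on subsets of [m] such that the marginal probability of each element i ∈ [m] under μ is at most ε₁, and let v_1,...,v_m ∈ ℝ^d be vectors with Σ_{i=1}^m v_i v_iᵀ = I and ‖v_i‖² ≤ ε₂ for all i. Then, writing ε = ε₁ + ε₂, there exists a set S ⊆ [m] with μ(S) > 0 such that ‖Σ_{i∈S} v_i v_iᵀ‖ ≤ 4ε + 2ε² (equivalently, Σ_{i∈S} v_i v_iᵀ ⪯ (4ε + 2ε²)·I). -/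
noncomputable section

/-- A polynomial `p ∈ ℝ[z_1,...,z_m]` is real stable if it has no root
`(z_1,...,z_m) ∈ ℂ^m` with `Im(z_i) > 0` for every `i`. -/
def RealStable {m : ℕ} (p : MvPolynomial (Fin m) ℝ) : Prop :=
  ∀ z : Fin m → ℂ, (∀ i, 0 < (z i).im) → (MvPolynomial.aeval z) p ≠ 0

/-- The generating polynomial of a distribution on subsets of `[m]`. -/
def genPoly {m : ℕ} (μ : Finset (Fin m) → ℝ) : MvPolynomial (Fin m) ℝ :=
  ∑ S : Finset (Fin m), MvPolynomial.C (μ S) * ∏ i ∈ S, MvPolynomial.X i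

/-! ### Quadratics -/

/-- Factorization of a complex quadratic. -/
lemma quad_factor (b0 b1 b2 : ℂ) (h2 : b2 ≠ 0) :
    ∃ r1 r2 : ℂ, b0 = b2 * (r1 * r2) ∧ b1 = - b2 * (r1 + r2) := by
  obtain ⟨s, hs⟩ := IsAlgClosed.exists_pow_nat_eq (discrim b2 b1 b0) (n := 2) (by norm_num)
  have hd : b1 ^ 2 - 4 * b2 * b0 = s ^ 2 := by rw [hs, discrim]
  refine ⟨(-b1 + s) / (2 * b2), (-b1 - s) / (2 * b2), ?_, ?_⟩
  · field_simp
    linear_combination -hd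
  · field_simp
    ring

lemma inv_im_pos {r : ℂ} (h : r.im < 0) : 0 < (r⁻¹).im := by
  rw [Complex.inv_im]
  have : 0 < Complex.normSq r := by
    rw [Complex.normSq_pos]; rintro rfl; simp at h
  exact div_pos (by linarith) this

/-- The quadratic lemma for the preservation of stability under `1 - ∂²`. -/
lemma quad_op_ne (b0 b1 b2 : ℂ) (h : ∀ t : ℂ, 0 ≤ t.im → b0 + t * b1 + t ^ 2 * b2 ≠ 0) :
    b0 - 2 * b2 ≠ 0 := by
  by_cases h2 : b2 = 0
  · have := h 0 (by simp)
    simpa [h2] using this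
  obtain ⟨r1, r2, e0, e1⟩ := quad_factor b0 b1 b2 h2
  have k1 : r1.im < 0 := by
    by_contra hc
    refine h r1 (not_lt.mp hc) ?_
    rw [e0, e1]; ring
  have k2 : r2.im < 0 := by
    by_contra hc
    refine h r2 (not_lt.mp hc) ?_
    rw [e0, e1]; ring
  intro hz
  have h12 : r1 * r2 = 2 := by
    have : b2 * (r1 * r2 - 2) = 0 := by rw [e0] at hz; linear_combination hz
    rcases mul_eq_zero.mp this with h | h
    · exact absurd h h2
    · linear_combination h
  have hr1 : r1 ≠ 0 := by rintro rfl; simp at k1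
  have : r2 = 2 * r1⁻¹ := by field_simp; linear_combination h12
  have h3 := inv_im_pos k1
  rw [this] at k2
  simp only [Complex.mul_im, Complex.re_ofNat, Complex.im_ofNat, zero_mul, add_zero] at k2
  linarith

/-- sign of the logarithmic derivative. -/
lemma quad_log_im (b0 b1 b2 : ℂ) (h : ∀ t : ℂ, 0 ≤ t.im → b0 + t * b1 + t ^ 2 * b2 ≠ 0) :
    (b1 * (starRingEnd ℂ) b0).im ≤ 0 := by
  have hb0 : b0 ≠ 0 := by simpa using h 0 (by simp)
  have key : (b1 / b0).im ≤ 0 := by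
    by_cases h2 : b2 = 0
    · by_cases h1 : b1 = 0
      · simp [h1]
      · have hr : (-b0 / b1).im < 0 := by
          by_contra hc
          refine h _ (not_lt.mp hc) ?_
          rw [h2]; field_simp; ring
        have := inv_im_pos hr
        have e : b1 / b0 = - (-b0 / b1)⁻¹ := by field_simp
        rw [e, Complex.neg_im]; linarith
    · obtain ⟨r1, r2, e0, e1⟩ := quad_factor b0 b1 b2 h2
      have k1 : r1.im < 0 := by
        by_contra hc
        refine h r1 (not_lt.mp hc) ?_
        rw [e0, e1]; ring
      have k2 : r2.im < 0 := by
        by_contra hc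
        refine h r2 (not_lt.mp hc) ?_
        rw [e0, e1]; ring
      have hr1 : r1 ≠ 0 := by rintro rfl; simp at k1
      have hr2 : r2 ≠ 0 := by rintro rfl; simp at k2
      have e : b1 / b0 = - (r1⁻¹ + r2⁻¹) := by
        rw [e0, e1]; field_simp; ring
      have := inv_im_pos k1
      have := inv_im_pos k2
      rw [e, Complex.neg_im, Complex.add_im]; linarith
  have hn : 0 < Complex.normSq b0 := Complex.normSq_pos.mpr hb0
  have e : b1 * (starRingEnd ℂ) b0 = (b1 / b0) * (Complex.normSq b0 : ℂ) := by
    rw [← Complex.mul_conj]; field_simp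
  rw [e, Complex.im_mul_ofReal]
  exact mul_nonpos_of_nonpos_of_nonneg key hn.le

/-- quantitative Hurwitz bound for affine functions. -/
lemma aff_bound (b0 b1 t : ℂ) (c : ℝ) (hc : 0 < c)
    (h : ∀ t : ℂ, - c < t.im → b0 + t * b1 ≠ 0) :
    ‖b0 + t * b1‖ ≤ (1 + ‖t‖ / c) * ‖b0‖ := by
  have key : c * ‖b1‖ ≤ ‖b0‖ := by
    by_cases h1 : b1 = 0
    · simp [h1]
    have : (-b0 / b1).im ≤ - c := by
      by_contra hh
      refine h _ (not_le.mp hh) ?_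
      field_simp; ring
    have h3 : c ≤ ‖-b0 / b1‖ := by
      refine le_trans ?_ (Complex.abs_im_le_norm _)
      rw [abs_of_neg (by linarith)]; linarith
    rw [norm_div, norm_neg, le_div_iff₀ (norm_pos_iff.mpr h1)] at h3
    exact h3
  calc ‖b0 + t * b1‖ ≤ ‖b0‖ + ‖t‖ * ‖b1‖ := by
        refine (norm_add_le _ _).trans ?_
        rw [norm_mul]
    _ ≤ ‖b0‖ + ‖t‖ * (‖b0‖ / c) := by
        gcongr
        rw [le_div_iff₀ hc]; linarith
    _ = _ := by field_simp

/-- Real consequences of the Pick condition for quadratics. -/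
lemma quad_pos_coef (b0 b1 b2 : ℝ) (hpos : ∀ t : ℝ, 0 ≤ t → 0 < b0 + b1 * t + b2 * t ^ 2)
    (hd : ∀ s : ℝ, (2 * b2 * b0 - b1 ^ 2) + 2 * s * (- b1 * b2) + s ^ 2 * (- 2 * b2 ^ 2) ≤ 0) :
    0 < b0 ∧ 0 ≤ b1 ∧ 0 ≤ b2 ∧ 4 * b0 * b2 ≤ b1 ^ 2 := by
  have h0 : 0 < b0 := by simpa using hpos 0 le_rfl
  have hb2 : 0 ≤ b2 := by
    by_contra hc
    push Not at hc
    have hh := hpos ((|b1| + b0) / (-b2) + 1) (by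
      have : 0 ≤ (|b1| + b0) / (-b2) := div_nonneg (by positivity) (by linarith)
      linarith)
    set t := (|b1| + b0) / (-b2) + 1 with ht
    have h1 : (-b2) * (t - 1) = |b1| + b0 := by
      have hne : -b2 ≠ 0 := by linarith
      rw [ht, add_sub_cancel_right, mul_div_cancel₀ _ hne]
    have ht1 : 1 ≤ t := by
      have : 0 ≤ (|b1| + b0) / (-b2) := div_nonneg (by positivity) (by linarith)
      linarith
    have h2 : b1 ≤ |b1| := le_abs_self b1
    nlinarith [mul_nonneg (sub_nonneg.mpr ht1) h0.le, mul_nonneg (sub_nonneg.mpr h2) (by linarith : 0 ≤ t)]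
  have hdisc : 4 * b0 * b2 ≤ b1 ^ 2 := by
    rcases hb2.eq_or_lt with h | h
    · rw [← h]; nlinarith [sq_nonneg b1]
    · have := hd (- b1 / (2 * b2))
      have e : (2 * b2 * b0 - b1 ^ 2) + 2 * (- b1 / (2 * b2)) * (- b1 * b2)
        + (- b1 / (2 * b2)) ^ 2 * (- 2 * b2 ^ 2) = (4 * b0 * b2 - b1 ^ 2) / 2 := by
        field_simp; ring
      linarith
  refine ⟨h0, ?_, hb2, hdisc⟩
  by_contra hc
  push Not at hc
  rcases hb2.eq_or_lt with h | h
  · have := hpos (b0 / (-b1)) (div_nonneg h0.le (by linarith))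
    rw [← h] at this
    have e : b0 + b1 * (b0 / -b1) = 0 := by
      have : b1 ≠ 0 := hc.ne
      field_simp; ring
    linarith
  · have := hpos (- b1 / (2 * b2)) (div_nonneg (by linarith) (by linarith))
    have e : b0 + b1 * (-b1 / (2 * b2)) + b2 * (-b1 / (2 * b2)) ^ 2
        = (4 * b0 * b2 - b1 ^ 2) / (4 * b2) := by field_simp; ring
    rw [e] at this
    have h4 : (4 * b0 * b2 - b1 ^ 2) / (4 * b2) ≤ 0 :=
      div_nonpos_of_nonpos_of_nonneg (by linarith) (by linarith)
    linarith

/-- Consequences of negative semidefiniteness of the Bezoutian. -/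
lemma bez (b0 b1 b2 a0 a1 a2 : ℝ) (h0 : 0 < b0) (h1 : 0 ≤ b1) (h2 : 0 ≤ b2)
    (hdisc : 4 * b0 * b2 ≤ b1 ^ 2)
    (hD : ∀ s : ℝ, (a1 * b0 - a0 * b1) + 2 * s * (a2 * b0 - a0 * b2)
      + s ^ 2 * (a2 * b1 - a1 * b2) ≤ 0) :
    a1 * b0 - a0 * b1 ≤ 0 ∧ a2 * b0 - a0 * b2 ≤ 0 ∧
      (a1 * b0 - a0 * b1) * b1 ≤ (a2 * b0 - a0 * b2) * b0 := by
  have pl : b0 * (a2 * b1 - a1 * b2) - b1 * (a2 * b0 - a0 * b2) + b2 * (a1 * b0 - a0 * b1) = 0 := by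
    ring
  generalize a1 * b0 - a0 * b1 = u at *
  generalize a2 * b0 - a0 * b2 = w at *
  generalize a2 * b1 - a1 * b2 = x at *
  have hu : u ≤ 0 := by simpa using hD 0
  have hdc : w ^ 2 ≤ u * x := by
    have := discrim_le_zero_of_nonpos (a := x) (b := 2 * w) (c := u) (fun s => by
      have := hD s; nlinarith)
    unfold discrim at this
    nlinarith
  have hx : x ≤ 0 := by
    by_contra hc
    push Not at hc
    have hu0 : u = 0 := by nlinarith [sq_nonneg w]
    have hw0 : w = 0 := by rw [hu0] at hdc; nlinarith [sq_nonneg w]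
    have := hD 1
    rw [hu0, hw0] at this; linarith
  rcases h1.eq_or_lt with h | h
  · have hb2 : b2 = 0 := by
      rw [← h] at hdisc; nlinarith
    have hx0 : x = 0 := by
      rw [← h, hb2] at pl
      have : b0 * x = 0 := by linarith
      rcases mul_eq_zero.mp this with h | h
      · linarith
      · exact h
    have hw0 : w = 0 := by rw [hx0] at hdc; nlinarith [sq_nonneg w]
    rw [hw0, ← h]; simp [hu]
  · have hw : w ≤ 0 := by
      have : b1 * w ≤ 0 := by nlinarith [mul_nonneg h0.le (neg_nonneg.mpr hx), mul_nonneg h2 (neg_nonneg.mpr hu)]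
      by_contra hc
      push Not at hc
      nlinarith [mul_pos h hc]
    refine ⟨hu, hw, ?_⟩
    -- b1 w = b0 x + b2 u
    have hw1 : b1 * w = b0 * x + b2 * u := by linarith
    -- suffices b1 * (u b1) ≤ b0 * (b1 w)
    have goal2 : b1 ^ 2 * u ≤ b0 * (b0 * x + b2 * u) := by
      rcases hx.eq_or_lt with hx0 | hx0
      · rw [hx0]; nlinarith [mul_nonneg (neg_nonneg.mpr hu) (by nlinarith [mul_nonneg h0.le h2] : 0 ≤ b1 ^ 2 - b0 * b2)]
      · -- (b0 x + b2 u)^2 ≤ b1^2 u x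
        have e1 : (b0 * x + b2 * u) ^ 2 ≤ b1 ^ 2 * (u * x) := by
          rw [← hw1, mul_pow]; exact mul_le_mul_of_nonneg_left hdc (sq_nonneg _)
        have e2 : (-x) * (b0 ^ 2 * x + 2 * b0 * b2 * u - b1 ^ 2 * u) ≥ 0 := by
          nlinarith [sq_nonneg (b2 * u)]
        have e3 : 0 ≤ b0 ^ 2 * x + 2 * b0 * b2 * u - b1 ^ 2 * u := by
          by_contra hc
          push Not at hc
          nlinarith [mul_pos (neg_pos.mpr hx0) (neg_pos.mpr hc)]
        nlinarith [mul_nonneg (mul_nonneg h0.le h2) (neg_nonneg.mpr hu)]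
    have : b1 * (w * b0 - u * b1) ≥ 0 := by nlinarith
    by_contra hc
    push Not at hc
    nlinarith [mul_pos h (by linarith : 0 < u * b1 - w * b0)]

/-- sharper form, giving convexity on an interval. -/
lemma bez_sharp (b0 b1 b2 a0 a1 a2 δ : ℝ) (h0 : 0 < b0) (h2 : 0 ≤ b2) (hδ : 0 ≤ δ)
    (hr : 0 ≤ b1 - 2 * b2 * δ) (hr0 : 0 < b0 - b1 * δ + b2 * δ ^ 2)
    (hdisc : 4 * b0 * b2 ≤ b1 ^ 2)
    (hD : ∀ s : ℝ, (a1 * b0 - a0 * b1) + 2 * s * (a2 * b0 - a0 * b2)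
      + s ^ 2 * (a2 * b1 - a1 * b2) ≤ 0) :
      (a1 * b0 - a0 * b1) * (b1 - b2 * δ) ≤ (a2 * b0 - a0 * b2) * b0 := by
  have h1 : 0 ≤ b1 := by nlinarith [mul_nonneg h2 hδ]
  obtain ⟨k1, k2, k3⟩ := bez b0 b1 b2 a0 a1 a2 h0 h1 h2 hdisc hD
  rcases h2.eq_or_lt with hb | hb
  · rw [← hb] at k3 ⊢; linarith
  have pl : b0 * (a2 * b1 - a1 * b2) - b1 * (a2 * b0 - a0 * b2) + b2 * (a1 * b0 - a0 * b1) = 0 := by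
    ring
  generalize a1 * b0 - a0 * b1 = u at *
  generalize a2 * b0 - a0 * b2 = w at *
  generalize a2 * b1 - a1 * b2 = x at *
  have hdc : w ^ 2 ≤ u * x := by
    have := discrim_le_zero_of_nonpos (a := x) (b := 2 * w) (c := u) (fun s => by
      have := hD s; nlinarith)
    unfold discrim at this
    nlinarith
  set D := Real.sqrt (b1 ^ 2 - 4 * b0 * b2) with hDdef
  have hDn : 0 ≤ D := Real.sqrt_nonneg _
  have hDsq : D ^ 2 = b1 ^ 2 - 4 * b0 * b2 := Real.sq_sqrt (by linarith)
  have hDle : D ≤ b1 - 2 * b2 * δ := by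
    apply Real.sqrt_le_iff.mpr ⟨hr, ?_⟩
    nlinarith [mul_pos hb hr0]
  set r := (b1 - D) / (2 * b2) with hrdef
  have hre : 2 * b2 * r = b1 - D := by rw [hrdef]; field_simp
  have hrδ : δ ≤ r := by
    rw [hrdef, le_div_iff₀ (by positivity)]; linarith
  have hroot : b0 - b1 * r + b2 * r ^ 2 = 0 := by
    have : 4 * b2 * (b0 - b1 * r + b2 * r ^ 2) = 0 := by
      have : 4 * b2 * (b0 - b1 * r + b2 * r ^ 2) = 4 * b0 * b2 - 2 * b1 * (2 * b2 * r) + (2 * b2 * r) ^ 2 := by ring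
      rw [this, hre]; nlinarith
    rcases mul_eq_zero.mp this with h | h
    · linarith
    · exact h
  have hrpos : 0 < r := by
    rcases (hδ.trans hrδ).eq_or_lt with h | h
    · rw [← h] at hroot; linarith
    · exact h
  have huw : u ≤ w * r := by
    rcases hDn.eq_or_lt with h | h
    · have hb1 : b1 = 2 * b2 * r := by rw [hre, ← h]; ring
      have hb0 : b0 = b2 * r ^ 2 := by rw [hb1] at hroot; linarith
      rw [hb0, hb1] at pl
      have e1 : r ^ 2 * x - 2 * r * w + u = 0 := by
        have : b2 * (r ^ 2 * x - 2 * r * w + u) = 0 := by linarith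
        rcases mul_eq_zero.mp this with h | h
        · linarith
        · exact h
      have e2 : (u - r * w) ^ 2 ≤ 0 := by
        have : r ^ 2 * w ^ 2 ≤ r ^ 2 * (u * x) := mul_le_mul_of_nonneg_left hdc (sq_nonneg r)
        have e3 : r ^ 2 * (u * x) = u * (2 * r * w - u) := by
          have : r ^ 2 * x = 2 * r * w - u := by linarith
          rw [← this]; ring
        nlinarith
      have : u - r * w = 0 := by nlinarith [sq_nonneg (u - r * w)]
      linarith
    · have hs := hD (-r)
      have e1 : b0 * (u + 2 * (-r) * w + (-r) ^ 2 * x) = (r * D) * (u - w * r) := by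
        have : b0 * x = b1 * w - b2 * u := by linarith
        have e4 : b0 * (u + 2 * (-r) * w + (-r) ^ 2 * x) = b0 * u - 2 * r * b0 * w + r ^ 2 * (b0 * x) := by ring
        have hDe : D = b1 - 2 * b2 * r := by linarith
        have hb0 : b0 = b1 * r - b2 * r ^ 2 := by linarith
        rw [e4, this, hDe, hb0]; ring
      have e2 : (r * D) * (u - w * r) ≤ 0 := by
        rw [← e1]; exact mul_nonpos_of_nonneg_of_nonpos h0.le hs
      by_contra hc
      push Not at hc
      nlinarith [mul_pos (mul_pos hrpos h) (sub_pos.mpr hc)]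
  have hb0 : b0 = r * (b1 - b2 * r) := by linarith
  have hnn : 0 ≤ b1 - b2 * r := by
    by_contra hc
    push Not at hc
    nlinarith
  calc u * (b1 - b2 * δ) ≤ u * (b1 - b2 * r) := by
        nlinarith [mul_nonneg (mul_nonneg (neg_nonneg.mpr k1) h2) (sub_nonneg.mpr hrδ)]
    _ ≤ (w * r) * (b1 - b2 * r) := mul_le_mul_of_nonneg_right huw hnn
    _ = w * b0 := by rw [hb0]; ring

/-- monotonicity of the barrier function. -/
lemma barrier_mono (b0 b1 b2 a0 a1 a2 t : ℝ) (ht : 0 ≤ t)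
    (hpos : ∀ t : ℝ, 0 ≤ t → 0 < b0 + b1 * t + b2 * t ^ 2)
    (hd : ∀ s : ℝ, (2 * b2 * b0 - b1 ^ 2) + 2 * s * (- b1 * b2) + s ^ 2 * (- 2 * b2 ^ 2) ≤ 0)
    (hD : ∀ s : ℝ, (a1 * b0 - a0 * b1) + 2 * s * (a2 * b0 - a0 * b2)
      + s ^ 2 * (a2 * b1 - a1 * b2) ≤ 0) :
    (a0 + a1 * t + a2 * t ^ 2) / (b0 + b1 * t + b2 * t ^ 2) ≤ a0 / b0 := by
  obtain ⟨h0, h1, h2, hdisc⟩ := quad_pos_coef b0 b1 b2 hpos hd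
  obtain ⟨k1, k2, k3⟩ := bez b0 b1 b2 a0 a1 a2 h0 h1 h2 hdisc hD
  rw [div_le_div_iff₀ (hpos t ht) h0]
  nlinarith [mul_nonneg ht (neg_nonneg.mpr k1), mul_nonneg (sq_nonneg t) (neg_nonneg.mpr k2)]

/-- the barrier update. -/
lemma barrier_step (b0 b1 b2 a0 a1 a2 δ : ℝ) (hδ : 0 < δ)
    (hpos : ∀ t : ℝ, 0 ≤ t → 0 < b0 + b1 * t + b2 * t ^ 2)
    (hd : ∀ s : ℝ, (2 * b2 * b0 - b1 ^ 2) + 2 * s * (- b1 * b2) + s ^ 2 * (- 2 * b2 ^ 2) ≤ 0)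
    (hD : ∀ s : ℝ, (a1 * b0 - a0 * b1) + 2 * s * (a2 * b0 - a0 * b2)
      + s ^ 2 * (a2 * b1 - a1 * b2) ≤ 0)
    (hφ : 2 * (b1 / b0) / δ + (b1 / b0) ^ 2 ≤ 1) :
    0 < (b0 + b1 * δ + b2 * δ ^ 2) - 2 * b2 ∧
    ((a0 + a1 * δ + a2 * δ ^ 2) - 2 * a2) / ((b0 + b1 * δ + b2 * δ ^ 2) - 2 * b2) ≤ a0 / b0 := by
  obtain ⟨h0, h1, h2, hdisc⟩ := quad_pos_coef b0 b1 b2 hpos hd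
  have hmono := barrier_mono b0 b1 b2 b1 (2 * b2) 0 δ hδ.le hpos hd (fun s => by
    have := hd s; nlinarith)
  -- coefficients at the shifted point
  set B0 := b0 + b1 * δ + b2 * δ ^ 2 with hB0
  set B1 := b1 + 2 * b2 * δ with hB1
  set A0 := a0 + a1 * δ + a2 * δ ^ 2 with hA0
  set A1 := a1 + 2 * a2 * δ with hA1
  have hB0p : 0 < B0 := hpos δ hδ.le
  have hB1n : 0 ≤ B1 := by positivity
  have hdisc' : 4 * B0 * b2 ≤ B1 ^ 2 := by rw [hB0, hB1]; nlinarith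
  have hD' : ∀ s : ℝ, (A1 * B0 - A0 * B1) + 2 * s * (a2 * B0 - A0 * b2)
      + s ^ 2 * (a2 * B1 - A1 * b2) ≤ 0 := by
    intro s
    have := hD (s + δ)
    rw [hB0, hB1, hA0, hA1]; nlinarith
  obtain ⟨k1, k2, k3⟩ := bez B0 B1 b2 A0 A1 a2 hB0p hB1n h2 hdisc' hD'
  have hφ' : B1 / B0 ≤ b1 / b0 := by
    have e : b1 + 2 * b2 * δ + 0 * δ ^ 2 = B1 := by rw [hB1]; ring
    rw [e] at hmono; exact hmono
  have hφ0 : 0 ≤ B1 / B0 := by positivity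
  set ψ := B1 / B0 with hψ
  have hB1e : B1 = ψ * B0 := by rw [hψ]; field_simp
  have h3 : 2 * ψ / δ + ψ ^ 2 ≤ 1 := by
    refine le_trans ?_ hφ
    gcongr
  have h4 : 2 * ψ + ψ ^ 2 * δ ≤ δ := by
    have := mul_le_mul_of_nonneg_right h3 hδ.le
    have e : (2 * ψ / δ + ψ ^ 2) * δ = 2 * ψ + ψ ^ 2 * δ := by field_simp
    rw [e] at this; linarith
  have h5 : 4 * b2 ≤ ψ ^ 2 * B0 := by
    rw [hB1e] at hdisc'
    have : B0 * (4 * b2) ≤ B0 * (ψ ^ 2 * B0) := by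
      have e : (ψ * B0) ^ 2 = B0 * (ψ ^ 2 * B0) := by ring
      linarith
    exact le_of_mul_le_mul_left this hB0p
  have hψ1 : ψ < 1 := by
    by_contra hc
    push Not at hc
    have := mul_le_mul_of_nonneg_right (one_le_pow₀ hc : 1 ≤ ψ ^ 2) hδ.le
    linarith
  have hq : 0 < B0 - 2 * b2 := by
    have : ψ ^ 2 < 1 := pow_lt_one₀ hφ0 hψ1 (by norm_num)
    have := mul_lt_mul_of_pos_right this hB0p
    linarith
  refine ⟨hq, ?_⟩
  -- convexity
  have hconv : A0 / B0 - δ * ((A1 * B0 - A0 * B1) / B0 ^ 2) ≤ a0 / b0 := by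
    have hs : a0 * B0 ^ 2 - b0 * (A0 * B0 - δ * (A1 * B0 - A0 * B1))
        = δ ^ 2 * ((a2 * B0 - A0 * b2) * B0 - (A1 * B0 - A0 * B1) * (B1 - b2 * δ)) := by
      rw [hB0, hB1, hA0, hA1]; ring
    have e : A0 / B0 - δ * ((A1 * B0 - A0 * B1) / B0 ^ 2)
      = (A0 * B0 - δ * (A1 * B0 - A0 * B1)) / B0 ^ 2 := by field_simp
    rw [e, div_le_div_iff₀ (by positivity) h0]
    have hnn : 0 ≤ δ ^ 2 * ((a2 * B0 - A0 * b2) * B0 - (A1 * B0 - A0 * B1) * (B1 - b2 * δ)) := by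
      apply mul_nonneg (sq_nonneg _)
      have := bez_sharp B0 B1 b2 A0 A1 a2 δ hB0p h2 hδ.le
        (by have : B1 - 2 * b2 * δ = b1 := by rw [hB1]; ring
            linarith)
        (by have : B0 - B1 * δ + b2 * δ ^ 2 = b0 := by rw [hB0, hB1]; ring
            linarith) hdisc' hD'
      linarith
    linarith
  refine le_trans ?_ hconv
  rw [div_le_iff₀ hq]
  have e : (A0 / B0 - δ * ((A1 * B0 - A0 * B1) / B0 ^ 2)) * (B0 - 2 * b2)
    = (A0 - 2 * a2) + (2 * (a2 * B0 - A0 * b2) * B0 - δ * (A1 * B0 - A0 * B1) * (B0 - 2 * b2)) / B0 ^ 2 := by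
    field_simp; ring
  rw [e]
  have : 0 ≤ (2 * (a2 * B0 - A0 * b2) * B0 - δ * (A1 * B0 - A0 * B1) * (B0 - 2 * b2)) / B0 ^ 2 := by
    apply div_nonneg _ (by positivity)
    have hk : 2 * B1 ≤ δ * (B0 - 2 * b2) := by
      have e1 := mul_le_mul_of_nonneg_right h4 hB0p.le
      have e2 := mul_le_mul_of_nonneg_left h5 hδ.le
      have e3 := mul_nonneg hδ.le h2
      have e4 : δ * (ψ ^ 2 * B0) = ψ ^ 2 * δ * B0 := by ring
      rw [hB1e]
      linarith
    nlinarith [mul_nonneg (neg_nonneg.mpr k1) (sub_nonneg.mpr hk)]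
  linarith

/-! ### Functions that are quadratic in each variable -/

section Fn

variable {m : ℕ}

/-- first derivative (for quadratics) as a central difference. -/
def fD (i : Fin m) (F : (Fin m → ℂ) → ℂ) : (Fin m → ℂ) → ℂ :=
  fun z => (F (z + Pi.single i 1) - F (z + Pi.single i (-1))) / 2

/-- second derivative (for quadratics) as a central difference. -/
def fD2 (i : Fin m) (F : (Fin m → ℂ) → ℂ) : (Fin m → ℂ) → ℂ :=
  fun z => F (z + Pi.single i 1) + F (z + Pi.single i (-1)) - 2 * F z

/-- the operator `1 - ∂_i²`. -/
def fop (i : Fin m) (F : (Fin m → ℂ) → ℂ) : (Fin m → ℂ) → ℂ :=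
  fun z => F z - fD2 i F z

/-- The class of real polynomial functions of degree at most two in each variable. -/
structure Nice (F : (Fin m → ℂ) → ℂ) : Prop where
  quad : ∀ i z t, F (z + Pi.single i t) = F z + t * fD i F z + t ^ 2 * (fD2 i F z / 2)
  cont : Continuous F
  conj : ∀ z : Fin m → ℂ, F (fun k => (starRingEnd ℂ) (z k)) = (starRingEnd ℂ) (F z)
  diag : ∀ a : Fin m → ℂ, ∃ R : Polynomial ℂ, ∀ x : ℂ, F (fun k => a k + x) = R.eval x

/-- stability. -/
def FStable (F : (Fin m → ℂ) → ℂ) : Prop := ∀ z : Fin m → ℂ, (∀ i, 0 < (z i).im) → F z ≠ 0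

lemma fD_fD2 (i j : Fin m) (F : (Fin m → ℂ) → ℂ) : fD j (fD2 i F) = fD2 i (fD j F) := by
  funext z
  simp only [fD, fD2, add_right_comm _ (Pi.single j _) (Pi.single i _)]
  ring

lemma fD_fop (i j : Fin m) (F : (Fin m → ℂ) → ℂ) : fD j (fop i F) = fop i (fD j F) := by
  funext z
  simp only [fop, fD, fD2, add_right_comm _ (Pi.single j _) (Pi.single i _)]
  ring

lemma Nice.shift {F : (Fin m → ℂ) → ℂ} (hF : Nice F) (j : Fin m) (c : ℂ)
    (hc : (starRingEnd ℂ) c = c) : Nice (fun z => F (z + Pi.single j c)) where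
  quad := by
    intro i z t
    have := hF.quad i (z + Pi.single j c) t
    simp only [fD, fD2, add_right_comm _ (Pi.single i _) (Pi.single j _)] at this ⊢
    exact this
  cont := hF.cont.comp (continuous_id.add continuous_const)
  conj := by
    intro z
    rw [← hF.conj]
    congr 1
    funext k
    by_cases h : k = j
    · subst h; simp [hc]
    · simp [h]
  diag := by
    intro a
    obtain ⟨R, hR⟩ := hF.diag (a + Pi.single j c)
    refine ⟨R, fun x => ?_⟩
    rw [← hR]
    congr 1
    funext k
    simp only [Pi.add_apply]
    ring

lemma Nice.add {F G : (Fin m → ℂ) → ℂ} (hF : Nice F) (hG : Nice G) :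
    Nice (fun z => F z + G z) where
  quad := by
    intro i z t
    have h1 := hF.quad i z t
    have h2 := hG.quad i z t
    simp only [fD, fD2] at *
    linear_combination h1 + h2
  cont := hF.cont.add hG.cont
  conj := by intro z; simp only [hF.conj, hG.conj, map_add]
  diag := by
    intro a
    obtain ⟨R, hR⟩ := hF.diag a
    obtain ⟨R', hR'⟩ := hG.diag a
    exact ⟨R + R', fun x => by simp [hR, hR']⟩

lemma Nice.smul {F : (Fin m → ℂ) → ℂ} (hF : Nice F) (c : ℝ) :
    Nice (fun z => (c : ℂ) * F z) where
  quad := by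
    intro i z t
    have := hF.quad i z t
    simp only [fD, fD2] at *
    linear_combination (c : ℂ) * this
  cont := continuous_const.mul hF.cont
  conj := by intro z; simp only [hF.conj, map_mul, Complex.conj_ofReal]
  diag := by
    intro a
    obtain ⟨R, hR⟩ := hF.diag a
    exact ⟨Polynomial.C (c : ℂ) * R, fun x => by simp [hR]⟩

lemma Nice.congr {F G : (Fin m → ℂ) → ℂ} (hF : Nice F) (h : ∀ z, G z = F z) : Nice G := by
  have : G = F := funext h
  rw [this]; exact hF

lemma Nice.fD {F : (Fin m → ℂ) → ℂ} (hF : Nice F) (i : Fin m) : Nice (fD i F) := by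
  refine (((hF.shift i 1 (by simp)).smul (1 / 2)).add
    ((hF.shift i (-1) (by simp)).smul (-1 / 2))).congr (fun z => ?_)
  simp only [_root_.fD]; push_cast; ring

lemma Nice.fD2 {F : (Fin m → ℂ) → ℂ} (hF : Nice F) (i : Fin m) : Nice (fD2 i F) := by
  refine (((hF.shift i 1 (by simp)).add
    (hF.shift i (-1) (by simp))).add (hF.smul (-2))).congr (fun z => ?_)
  simp only [_root_.fD2]; push_cast; ring

lemma Nice.fop {F : (Fin m → ℂ) → ℂ} (hF : Nice F) (i : Fin m) : Nice (fop i F) := by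
  refine (hF.add ((hF.fD2 i).smul (-1))).congr (fun z => ?_)
  simp only [_root_.fop]; push_cast; ring

lemma Nice.fD_fD {F : (Fin m → ℂ) → ℂ} (hF : Nice F) (i : Fin m) : _root_.fD i (_root_.fD i F) = _root_.fD2 i F := by
  funext z
  have h2 := hF.quad i z 2
  have h3 := hF.quad i z (-2)
  have e1 : z + Pi.single i (1 : ℂ) + Pi.single i 1 = z + Pi.single i 2 := by
    rw [add_assoc, ← Pi.single_add]; norm_num
  have e2 : z + Pi.single i (-1 : ℂ) + Pi.single i (-1) = z + Pi.single i (-2) := by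
    rw [add_assoc, ← Pi.single_add]; norm_num
  have e3 : z + Pi.single i (1 : ℂ) + Pi.single i (-1) = z := by
    rw [add_assoc, ← Pi.single_add]; norm_num
  have e4 : z + Pi.single i (-1 : ℂ) + Pi.single i 1 = z := by
    rw [add_assoc, ← Pi.single_add]; norm_num
  simp only [_root_.fD, _root_.fD2, e1, e2, e3, e4] at *
  linear_combination (h2 + h3) / 4

lemma Nice.fD2_fD {F : (Fin m → ℂ) → ℂ} (hF : Nice F) (i : Fin m) (z : Fin m → ℂ) :
    _root_.fD2 i (_root_.fD i F) z = 0 := by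
  have h2 := hF.quad i z 2
  have h3 := hF.quad i z (-2)
  have e1 : z + Pi.single i (1 : ℂ) + Pi.single i 1 = z + Pi.single i 2 := by
    rw [add_assoc, ← Pi.single_add]; norm_num
  have e2 : z + Pi.single i (-1 : ℂ) + Pi.single i (-1) = z + Pi.single i (-2) := by
    rw [add_assoc, ← Pi.single_add]; norm_num
  have e3 : z + Pi.single i (1 : ℂ) + Pi.single i (-1) = z := by
    rw [add_assoc, ← Pi.single_add]; norm_num
  have e4 : z + Pi.single i (-1 : ℂ) + Pi.single i 1 = z := by
    rw [add_assoc, ← Pi.single_add]; norm_num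
  simp only [_root_.fD, _root_.fD2, e1, e2, e3, e4] at *
  linear_combination (h2 - h3) / 2

lemma uhp_add_single {z : Fin m → ℂ} (hz : ∀ i, 0 < (z i).im) (i : Fin m) (t : ℂ)
    (ht : - (z i).im < t.im) : ∀ k, 0 < ((z + Pi.single i t : Fin m → ℂ) k).im := by
  intro k
  by_cases h : k = i
  · subst h; simp; linarith
  · simp [h, hz k]

lemma FStable.fop {F : (Fin m → ℂ) → ℂ} (hF : Nice F) (hS : FStable F) (i : Fin m) :
    FStable (fop i F) := by
  intro z hz
  have := quad_op_ne (F z) (fD i F z) (fD2 i F z / 2) (fun t ht => by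
    rw [← hF.quad]
    exact hS _ (uhp_add_single hz i t (by have := hz i; linarith)))
  simp only [_root_.fop]
  intro h
  apply this
  linear_combination h

/-- Sign of the logarithmic derivative on the closed upper half plane. -/
lemma pick_closed {F : (Fin m → ℂ) → ℂ} (hF : Nice F) (hS : FStable F) (j : Fin m)
    (z : Fin m → ℂ) (hz : ∀ i, 0 ≤ (z i).im) :
    (fD j F z * (starRingEnd ℂ) (F z)).im ≤ 0 := by
  have hopen : ∀ w : Fin m → ℂ, (∀ i, 0 < (w i).im) → (fD j F w * (starRingEnd ℂ) (F w)).im ≤ 0 := by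
    intro w hw
    refine quad_log_im (F w) (fD j F w) (fD2 j F w / 2) (fun t ht => ?_)
    rw [← hF.quad]
    exact hS _ (uhp_add_single hw j t (by have := hw j; linarith))
  have hc : Continuous (fun η : ℝ => (fD j F (fun k => z k + η * Complex.I) *
      (starRingEnd ℂ) (F (fun k => z k + η * Complex.I))).im) := by
    have h1 : Continuous (fun η : ℝ => (fun k => z k + η * Complex.I : Fin m → ℂ)) := by fun_prop
    exact Complex.continuous_im.comp (((hF.fD j).cont.comp h1).mul
      (Complex.continuous_conj.comp (hF.cont.comp h1)))
  have ht := (hc.tendsto 0).mono_left (nhdsWithin_le_nhds (s := Set.Ioi (0 : ℝ)))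
  have := le_of_tendsto ht (b := 0) (by
    filter_upwards [self_mem_nhdsWithin] with η hη
    refine hopen _ (fun i => ?_)
    have : (0 : ℝ) < η := hη
    have := hz i
    simp; linarith)
  simpa using this

/-- embedding of real points. -/
def rc (x : Fin m → ℝ) : Fin m → ℂ := fun k => (x k : ℂ)

/-- real values at real points. -/
def val (F : (Fin m → ℂ) → ℂ) (x : Fin m → ℝ) : ℝ := (F (rc x)).re

lemma rc_add_single (x : Fin m → ℝ) (i : Fin m) (t : ℝ) :
    rc (x + Pi.single i t) = rc x + Pi.single i (t : ℂ) := by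
  funext k
  by_cases h : k = i
  · subst h; simp [rc]
  · simp [rc, h]

lemma Nice.val_eq {F : (Fin m → ℂ) → ℂ} (hF : Nice F) (x : Fin m → ℝ) :
    F (rc x) = (val F x : ℂ) := by
  have := hF.conj (rc x)
  have e : (fun k => (starRingEnd ℂ) (rc x k)) = rc x := by funext k; simp [rc]
  rw [e] at this
  exact (Complex.conj_eq_iff_re.mp this.symm).symm

lemma Nice.val_quad {F : (Fin m → ℂ) → ℂ} (hF : Nice F) (x : Fin m → ℝ) (i : Fin m) (t : ℝ) :
    val F (x + Pi.single i t) =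
      val F x + val (_root_.fD i F) x * t + (val (_root_.fD2 i F) x / 2) * t ^ 2 := by
  have := hF.quad i (rc x) t
  rw [← rc_add_single, hF.val_eq, hF.val_eq, (hF.fD i).val_eq, (hF.fD2 i).val_eq] at this
  have h2 : (val F (x + Pi.single i t)) =
    (val F x + t * val (_root_.fD i F) x + t ^ 2 * (val (_root_.fD2 i F) x / 2)) := by
    exact_mod_cast this
  rw [h2]; ring

lemma nonpos_of_small (c d : ℝ) (h : ∀ η : ℝ, 0 < η → c + η ^ 2 * d ≤ 0) : c ≤ 0 := by
  have hc : Continuous (fun η : ℝ => c + η ^ 2 * d) := by fun_prop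
  have ht := (hc.tendsto 0).mono_left (nhdsWithin_le_nhds (s := Set.Ioi (0 : ℝ)))
  have := le_of_tendsto ht (b := 0) (by
    filter_upwards [self_mem_nhdsWithin] with η hη
    exact h η hη)
  simpa using this

/-- The Bezoutian inequality at real points. -/
lemma pick_real {F : (Fin m → ℂ) → ℂ} (hF : Nice F) (hS : FStable F) (i j : Fin m)
    (x : Fin m → ℝ) (b0 b1 b2 a0 a1 a2 : ℝ) (hb0 : b0 = val F x) (hb1 : b1 = val (fD i F) x)
    (hb2 : b2 = val (fD2 i F) x / 2) (ha0 : a0 = val (fD j F) x)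
    (ha1 : a1 = val (fD i (fD j F)) x) (ha2 : a2 = val (fD2 i (fD j F)) x / 2) (s : ℝ) :
    (a1 * b0 - a0 * b1) + 2 * s * (a2 * b0 - a0 * b2) + s ^ 2 * (a2 * b1 - a1 * b2) ≤ 0 := by
  apply nonpos_of_small _ (a2 * b1 - a1 * b2)
  intro η hη
  have h := pick_closed hF hS j (rc x + Pi.single i (s + η * Complex.I)) (fun k => by
    by_cases h : k = i
    · subst h; simp [rc]; exact hη.le
    · simp [rc, h])
  rw [hF.quad, (hF.fD j).quad, hF.val_eq, (hF.fD i).val_eq, (hF.fD2 i).val_eq, (hF.fD j).val_eq,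
    ((hF.fD j).fD i).val_eq, ((hF.fD j).fD2 i).val_eq] at h
  have e2 : (((val (fD2 i F) x : ℝ) : ℂ) / 2) = (b2 : ℂ) := by rw [hb2]; push_cast; ring
  have e3 : (((val (fD2 i (fD j F)) x : ℝ) : ℂ) / 2) = (a2 : ℂ) := by rw [ha2]; push_cast; ring
  rw [e2, e3, ← hb0, ← hb1, ← ha0, ← ha1] at h
  simp only [pow_two, Complex.mul_im, Complex.mul_re, Complex.add_im, Complex.add_re, Complex.ofReal_re,
    Complex.ofReal_im, Complex.I_re, Complex.I_im, Complex.conj_re, Complex.conj_im] at h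
  have : η * ((a1 * b0 - a0 * b1) + 2 * s * (a2 * b0 - a0 * b2) + s ^ 2 * (a2 * b1 - a1 * b2)
    + η ^ 2 * (a2 * b1 - a1 * b2)) ≤ 0 := by
    refine le_trans (le_of_eq ?_) h
    ring
  by_contra hc
  push Not at hc
  have := mul_pos hη hc
  linarith

lemma pick_self {F : (Fin m → ℂ) → ℂ} (hF : Nice F) (hS : FStable F) (i : Fin m)
    (x : Fin m → ℝ) (b0 b1 b2 : ℝ) (hb0 : b0 = val F x) (hb1 : b1 = val (fD i F) x)
    (hb2 : b2 = val (fD2 i F) x / 2) (s : ℝ) :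
    (2 * b2 * b0 - b1 ^ 2) + 2 * s * (- b1 * b2) + s ^ 2 * (- 2 * b2 ^ 2) ≤ 0 := by
  have := pick_real hF hS i i x b0 b1 b2 b1 (2 * b2) 0 hb0 hb1 hb2 hb1
    (by rw [hF.fD_fD, hb2]; ring)
    (by have : val (fD2 i (fD i F)) x = 0 := by
          unfold val; rw [hF.fD2_fD]; simp
        rw [this]; simp) s
  nlinarith

/-- being above the roots. -/
def Above (F : (Fin m → ℂ) → ℂ) (x : Fin m → ℝ) : Prop := ∀ y, x ≤ y → 0 < val F y

/-- barrier function. -/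
def Phi (F : (Fin m → ℂ) → ℂ) (j : Fin m) (x : Fin m → ℝ) : ℝ := val (fD j F) x / val F x

lemma le_add_single (x : Fin m → ℝ) (i : Fin m) {t : ℝ} (ht : 0 ≤ t) : x ≤ x + Pi.single i t := by
  have : (0 : Fin m → ℝ) ≤ Pi.single i t := by simpa using ht
  exact le_add_of_nonneg_right this

lemma Above.mono {F : (Fin m → ℂ) → ℂ} {x y : Fin m → ℝ} (h : Above F x) (hxy : x ≤ y) :
    Above F y := fun w hw => h w (hxy.trans hw)

lemma Above.line {F : (Fin m → ℂ) → ℂ} (hF : Nice F) {x : Fin m → ℝ} (h : Above F x) (i : Fin m)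
    (t : ℝ) (ht : 0 ≤ t) :
    0 < val F x + val (fD i F) x * t + (val (fD2 i F) x / 2) * t ^ 2 := by
  rw [← hF.val_quad]; exact h _ (le_add_single x i ht)

lemma Phi_mono_single {F : (Fin m → ℂ) → ℂ} (hF : Nice F) (hS : FStable F) {x : Fin m → ℝ}
    (h : Above F x) (i j : Fin m) (t : ℝ) (ht : 0 ≤ t) :
    Phi F j (x + Pi.single i t) ≤ Phi F j x := by
  unfold Phi
  rw [hF.val_quad, (hF.fD j).val_quad]
  exact barrier_mono _ _ _ _ _ _ t ht (h.line hF i)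
    (pick_self hF hS i x _ _ _ rfl rfl rfl)
    (pick_real hF hS i j x _ _ _ _ _ _ rfl rfl rfl rfl rfl rfl)

lemma Phi_mono {F : (Fin m → ℂ) → ℂ} (hF : Nice F) (hS : FStable F) {x y : Fin m → ℝ}
    (h : Above F x) (j : Fin m) (hxy : x ≤ y) : Phi F j y ≤ Phi F j x := by
  have key : ∀ s : Finset (Fin m),
      x ≤ x + ∑ i ∈ s, Pi.single i (y i - x i) ∧
      Phi F j (x + ∑ i ∈ s, Pi.single i (y i - x i)) ≤ Phi F j x := by
    intro s
    induction s using Finset.induction_on with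
    | empty => simp
    | insert a s ha ih =>
      rw [Finset.sum_insert ha, add_comm (Pi.single a _), ← add_assoc]
      have hn : 0 ≤ y a - x a := sub_nonneg.mpr (hxy a)
      exact ⟨ih.1.trans (le_add_single _ _ hn),
        (Phi_mono_single hF hS (h.mono ih.1) a j _ hn).trans ih.2⟩
  have := (key Finset.univ).2
  have e : x + ∑ i, Pi.single i (y i - x i) = y := by
    have := Finset.univ_sum_single (y - x)
    simp only [Pi.sub_apply] at this
    rw [this]; abel
  rwa [e] at this

lemma step_point {F : (Fin m → ℂ) → ℂ} (hF : Nice F) (hS : FStable F) {x : Fin m → ℝ}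
    (h : Above F x) (i : Fin m) (φ δ : ℝ) (hδ : 0 < δ) (hφ : Phi F i x ≤ φ)
    (hφδ : 2 * φ / δ + φ ^ 2 ≤ 1) :
    0 < val (fop i F) (x + Pi.single i δ) ∧
      ∀ j, Phi (fop i F) j (x + Pi.single i δ) ≤ Phi F j x := by
  have hline := h.line hF i
  have hself := pick_self hF hS i x _ _ _ rfl rfl rfl
  obtain ⟨h0, h1, h2, -⟩ := quad_pos_coef _ _ _ hline hself
  have hnn : 0 ≤ Phi F i x := div_nonneg h1 h0.le
  have hcond : 2 * (val (fD i F) x / val F x) / δ + (val (fD i F) x / val F x) ^ 2 ≤ 1 := by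
    refine le_trans ?_ hφδ
    unfold Phi at hφ hnn
    gcongr
  have hval : ∀ G : (Fin m → ℂ) → ℂ, Nice G → val (fop i G) (x + Pi.single i δ)
      = (val G x + val (fD i G) x * δ + val (fD2 i G) x / 2 * δ ^ 2) - 2 * (val (fD2 i G) x / 2) := by
    intro G hG
    have e1 : val (fop i G) (x + Pi.single i δ) = val G (x + Pi.single i δ)
        - val (fD2 i G) (x + Pi.single i δ) := by
      simp [val, fop]
    have e2 : val (fD2 i G) (x + Pi.single i δ) = val (fD2 i G) x := by
      rw [(hG.fD2 i).val_quad]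
      have e3 : val (fD i (fD2 i G)) x = 0 := by
        rw [fD_fD2]; unfold val; rw [hG.fD2_fD]; simp
      have e4 : val (fD2 i (fD2 i G)) x = 0 := by
        have : fD2 i (fD2 i G) = fD2 i (fD i (fD i G)) := by rw [hG.fD_fD]
        rw [this]; unfold val; rw [(hG.fD i).fD2_fD]; simp
      rw [e3, e4]; ring
    rw [e1, e2, hG.val_quad]; ring
  have hb := fun j => barrier_step _ _ _ _ _ _ δ hδ hline hself
    (pick_real hF hS i j x _ _ _ _ _ _ rfl rfl rfl rfl rfl rfl) hcond
  refine ⟨?_, fun j => ?_⟩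
  · rw [hval F hF]; exact (hb i).1
  · unfold Phi
    rw [fD_fop, hval F hF, hval _ (hF.fD j)]
    exact (hb j).2

lemma step_above {F : (Fin m → ℂ) → ℂ} (hF : Nice F) (hS : FStable F) {x : Fin m → ℝ}
    (h : Above F x) (i : Fin m) (φ δ : ℝ) (hδ : 0 < δ) (hφ : Phi F i x ≤ φ)
    (hφδ : 2 * φ / δ + φ ^ 2 ≤ 1) : Above (fop i F) (x + Pi.single i δ) := by
  intro y hy
  have hx : x ≤ y - Pi.single i δ := le_sub_iff_add_le.mpr hy
  have := (step_point hF hS (h.mono hx) i φ δ hδ ((Phi_mono hF hS h i hx).trans hφ) hφδ).1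
  rwa [sub_add_cancel] at this

/-- iterated operator. -/
def opL (L : List (Fin m)) (F : (Fin m → ℂ) → ℂ) : (Fin m → ℂ) → ℂ := L.foldr fop F

lemma opL_nice (L : List (Fin m)) {F : (Fin m → ℂ) → ℂ} (hF : Nice F) : Nice (opL L F) := by
  induction L with
  | nil => exact hF
  | cons a L ih => exact ih.fop a

lemma opL_stable (L : List (Fin m)) {F : (Fin m → ℂ) → ℂ} (hF : Nice F) (hS : FStable F) :
    FStable (opL L F) := by
  induction L with
  | nil => exact hS
  | cons a L ih => exact ih.fop (opL_nice L hF) a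

lemma barrier_list (L : List (Fin m)) {F : (Fin m → ℂ) → ℂ} (hF : Nice F) (hS : FStable F)
    {x : Fin m → ℝ} (h : Above F x) (φ δ : ℝ) (hδ : 0 < δ) (hφ : ∀ j, Phi F j x ≤ φ)
    (hφδ : 2 * φ / δ + φ ^ 2 ≤ 1) :
    Above (opL L F) (x + (L.map (fun i => Pi.single i δ)).sum) ∧
      ∀ j, Phi (opL L F) j (x + (L.map (fun i => Pi.single i δ)).sum) ≤ φ := by
  induction L with
  | nil => simpa [opL] using ⟨h, hφ⟩
  | cons a L ih =>
    rw [List.map_cons, List.sum_cons, add_comm (Pi.single a δ : Fin m → ℝ), ← add_assoc]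
    have hN := opL_nice L hF
    have hSt := opL_stable L hF hS
    exact ⟨step_above hN hSt ih.1 a φ δ hδ (ih.2 a) hφδ,
      fun j => ((step_point hN hSt ih.1 a φ δ hδ (ih.2 a) hφδ).2 j).trans (ih.2 j)⟩

lemma barrier_all {F : (Fin m → ℂ) → ℂ} (hF : Nice F) (hS : FStable F)
    {t : ℝ} (h : Above F (fun _ => t)) (φ δ : ℝ) (hδ : 0 < δ) (hφ : ∀ j, Phi F j (fun _ => t) ≤ φ)
    (hφδ : 2 * φ / δ + φ ^ 2 ≤ 1) :
    Above (opL (List.finRange m) F) (fun _ => t + δ) := by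
  have := (barrier_list (List.finRange m) hF hS h φ δ hδ hφ hφδ).1
  rw [← Fin.sum_univ_def, Finset.univ_sum_single (fun _ => δ)] at this
  exact this

/-- Monotonicity along the diagonal. -/
lemma diag_mono {F : (Fin m → ℂ) → ℂ} (hF : Nice F) (hS : FStable F) {T : ℝ}
    (hT : ∀ x, T ≤ x → 0 < val F (fun _ => x)) {x : ℝ} (hx : T ≤ x) :
    val F (fun _ => T) ≤ val F (fun _ => x) := by
  obtain ⟨R, hR⟩ := hF.diag (fun _ => 0)
  simp only [zero_add] at hR
  have hRv : ∀ y : ℝ, R.eval (y : ℂ) = (val F (fun _ => y) : ℂ) := by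
    intro y
    rw [← hR, ← hF.val_eq]; rfl
  have hR0 : R ≠ 0 := by
    rintro rfl
    have h1 := hRv T
    have h2 := hT T le_rfl
    rw [Polynomial.eval_zero] at h1
    have h3 : val F (fun _ => T) = 0 := by exact_mod_cast h1.symm
    linarith
  have hroot : ∀ r ∈ R.roots, ∃ s : ℝ, r = s ∧ s < T := by
    intro r hr
    have hr0 : R.eval r = 0 := (Polynomial.mem_roots hR0).mp hr
    have him : r.im = 0 := by
      rcases lt_trichotomy r.im 0 with h | h | h
      · exfalso
        refine hS (fun _ => (starRingEnd ℂ) r) (fun i => by simpa using h) ?_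
        rw [hF.conj (fun _ => r), hR, hr0, map_zero]
      · exact h
      · exfalso
        refine hS (fun _ => r) (fun i => h) ?_
        rw [hR, hr0]
    have hre : r = (r.re : ℂ) := Complex.ext rfl (by simp [him])
    refine ⟨r.re, hre, ?_⟩
    by_contra hc
    have h1 := hT r.re (not_lt.mp hc)
    have h2 := hRv r.re
    rw [← hre, hr0] at h2
    have h3 : val F (fun _ => r.re) = 0 := by exact_mod_cast h2.symm
    linarith
  have hnorm : ∀ y : ℝ, T ≤ y → val F (fun _ => y) = ‖R.leadingCoeff‖ * (R.roots.map (fun r => ‖(y : ℂ) - r‖)).prod := by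
    intro y hy
    have h1 : ‖R.eval (y : ℂ)‖ = val F (fun _ => y) := by
      rw [hRv, Complex.norm_real, Real.norm_of_nonneg (hT y hy).le]
    rw [← h1, (IsAlgClosed.splits R).eval_eq_prod_roots, norm_mul]
    have h2 := Multiset.prod_hom (R.roots.map (fun r => (y : ℂ) - r)) (normHom : ℂ →*₀ ℝ)
    rw [Multiset.map_map] at h2
    have h3 : ‖(R.roots.map (fun r => (y : ℂ) - r)).prod‖
      = (R.roots.map (fun r => ‖(y : ℂ) - r‖)).prod := h2.symm
    rw [h3]
  rw [hnorm T le_rfl, hnorm x hx]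
  apply mul_le_mul_of_nonneg_left _ (norm_nonneg _)
  apply Multiset.prod_map_le_prod_map₀
  · intro r _; exact norm_nonneg _
  · intro r hr
    obtain ⟨s, rfl, hs⟩ := hroot r hr
    rw [← Complex.ofReal_sub, ← Complex.ofReal_sub, Complex.norm_real, Complex.norm_real,
      Real.norm_of_nonneg (by linarith), Real.norm_of_nonneg (by linarith)]
    linarith

end Fn

/-! ### The two concrete polynomials -/

section Concrete

variable {m d : ℕ}

/-- Multiaffine real polynomial functions. -/
structure PreNice (F : (Fin m → ℂ) → ℂ) : Prop where
  aff : ∀ i z, ∃ c, ∀ t, F (z + Pi.single i t) = F z + t * c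
  cont : Continuous F
  conj : ∀ z : Fin m → ℂ, F (fun k => (starRingEnd ℂ) (z k)) = (starRingEnd ℂ) (F z)
  diag : ∀ a : Fin m → ℂ, ∃ R : Polynomial ℂ, ∀ x : ℂ, F (fun k => a k + x) = R.eval x

lemma PreNice.mul {G H : (Fin m → ℂ) → ℂ} (hG : PreNice G) (hH : PreNice H) :
    Nice (fun z => G z * H z) where
  quad := by
    intro i z t
    obtain ⟨c, hc⟩ := hG.aff i z
    obtain ⟨c', hc'⟩ := hH.aff i z
    simp only [fD, fD2, hc, hc']
    ring
  cont := hG.cont.mul hH.cont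
  conj := by intro z; simp only [hG.conj, hH.conj, map_mul]
  diag := by
    intro a
    obtain ⟨R, hR⟩ := hG.diag a
    obtain ⟨R', hR'⟩ := hH.diag a
    exact ⟨R * R', fun x => by simp [hR, hR']⟩

lemma fD_mul {G H : (Fin m → ℂ) → ℂ} (i : Fin m) (z : Fin m → ℂ) (c c' : ℂ)
    (hc : ∀ t, G (z + Pi.single i t) = G z + t * c)
    (hc' : ∀ t, H (z + Pi.single i t) = H z + t * c') :
    fD i (fun z => G z * H z) z = c * H z + G z * c' := by
  simp only [fD, hc, hc']; ring

/-- generating function of `μ`. -/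
def Gf (μ : Finset (Fin m) → ℝ) (z : Fin m → ℂ) : ℂ := ∑ S, (μ S : ℂ) * ∏ i ∈ S, z i

/-- derivative of the generating function. -/
def Gd (μ : Finset (Fin m) → ℝ) (i : Fin m) (z : Fin m → ℂ) : ℂ :=
  ∑ S, (μ S : ℂ) * (if i ∈ S then ∏ k ∈ S.erase i, z k else 0)

lemma prod_add_single (S : Finset (Fin m)) (z : Fin m → ℂ) (i : Fin m) (t : ℂ) :
    ∏ k ∈ S, (z + Pi.single i t : Fin m → ℂ) k
      = ∏ k ∈ S, z k + t * (if i ∈ S then ∏ k ∈ S.erase i, z k else 0) := by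
  split_ifs with h
  · rw [← Finset.mul_prod_erase S _ h, ← Finset.mul_prod_erase S z h]
    have : ∏ k ∈ S.erase i, (z + Pi.single i t : Fin m → ℂ) k = ∏ k ∈ S.erase i, z k := by
      refine Finset.prod_congr rfl (fun k hk => ?_)
      simp [Finset.ne_of_mem_erase hk]
    rw [this]; simp; ring
  · rw [mul_zero, add_zero]
    refine Finset.prod_congr rfl (fun k hk => ?_)
    have : k ≠ i := fun h' => h (h' ▸ hk)
    simp [this]

lemma Gf_add_single (μ : Finset (Fin m) → ℝ) (z : Fin m → ℂ) (i : Fin m) (t : ℂ) :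
    Gf μ (z + Pi.single i t) = Gf μ z + t * Gd μ i z := by
  unfold Gf Gd
  rw [Finset.mul_sum, ← Finset.sum_add_distrib]
  refine Finset.sum_congr rfl (fun S _ => ?_)
  rw [prod_add_single]; ring

lemma Gf_preNice (μ : Finset (Fin m) → ℝ) : PreNice (Gf μ) where
  aff := fun i z => ⟨Gd μ i z, fun t => Gf_add_single μ z i t⟩
  cont := by unfold Gf; fun_prop
  conj := by intro z; simp [Gf]
  diag := by
    intro a
    refine ⟨∑ S, Polynomial.C (μ S : ℂ) * ∏ i ∈ S, (Polynomial.C (a i) + Polynomial.X), fun x => ?_⟩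
    simp [Gf, Polynomial.eval_finset_sum, Polynomial.eval_prod]

/-- complexified vector -/
def cv (v : Fin m → Fin d → ℝ) (i : Fin m) : Fin d → ℂ := fun k => (v i k : ℂ)

/-- the determinantal polynomial. -/
def Hf (v : Fin m → Fin d → ℝ) (z : Fin m → ℂ) : ℂ :=
  (∑ i, z i • Matrix.vecMulVec (cv v i) (cv v i)).det

lemma det_rank_one {K : Type*} [CommRing K] (A : Matrix (Fin d) (Fin d) K) (u w : Fin d → K) :
    ∃ c, ∀ t : K, (A + t • Matrix.vecMulVec u w).det = A.det + t * c := by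
  let M : K → Matrix (Fin d ⊕ Unit) (Fin d ⊕ Unit) K := fun t =>
    Matrix.fromBlocks A (Matrix.replicateCol Unit (-t • u)) (Matrix.replicateRow Unit w) 1
  have hM : ∀ t, (M t).det = (A + t • Matrix.vecMulVec u w).det := by
    intro t
    simp only [M]
    rw [Matrix.det_fromBlocks_one₂₂, ← Matrix.vecMulVec_eq]
    congr 1
    ext i j
    simp [Matrix.vecMulVec_apply]
  have hcol : ∀ t, M t = (M 0).updateCol (Sum.inr ())
      ((fun k => M 0 k (Sum.inr ())) + t • (Sum.elim (-u) 0)) := by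
    intro t
    ext i j
    rcases j with j | j
    · rcases i with i | i <;> simp [M, Matrix.updateCol_apply]
    · rcases i with i | i <;> simp [M, Matrix.updateCol_apply]
  refine ⟨((M 0).updateCol (Sum.inr ()) (Sum.elim (-u) 0)).det, fun t => ?_⟩
  rw [← hM t, hcol t, Matrix.det_updateCol_add, Matrix.det_updateCol_smul]
  congr 1
  have : (M 0).updateCol (Sum.inr ()) (fun k => M 0 k (Sum.inr ())) = M 0 :=
    Matrix.updateCol_eq_self _ _
  rw [this, hM 0]; simp

lemma sum_add_single (v : Fin m → Fin d → ℝ) (z : Fin m → ℂ) (i : Fin m) (t : ℂ) :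
    ∑ k, (z + Pi.single i t : Fin m → ℂ) k • Matrix.vecMulVec (cv v k) (cv v k)
      = (∑ k, z k • Matrix.vecMulVec (cv v k) (cv v k)) + t • Matrix.vecMulVec (cv v i) (cv v i) := by
  simp only [Pi.add_apply, add_smul, Finset.sum_add_distrib]
  congr 1
  rw [Finset.sum_eq_single i]
  · simp
  · intro b _ hb; simp [hb]
  · simp

lemma Hf_preNice (v : Fin m → Fin d → ℝ) : PreNice (Hf v) where
  aff := by
    intro i z
    obtain ⟨c, hc⟩ := det_rank_one (∑ k, z k • Matrix.vecMulVec (cv v k) (cv v k)) (cv v i) (cv v i)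
    exact ⟨c, fun t => by unfold Hf; rw [sum_add_single, hc]⟩
  cont := by
    unfold Hf
    apply Continuous.matrix_det
    fun_prop
  conj := by
    intro z
    unfold Hf
    rw [RingHom.map_det]
    congr 1
    ext a b
    simp [Matrix.sum_apply, Matrix.vecMulVec_apply, cv]
  diag := by
    intro a
    refine ⟨(∑ i, (Polynomial.C (a i) + Polynomial.X) •
      (Matrix.vecMulVec (cv v i) (cv v i)).map Polynomial.C).det, fun x => ?_⟩
    rw [← Polynomial.coe_evalRingHom, RingHom.map_det]
    unfold Hf
    congr 1
    ext p q
    simp [Matrix.sum_apply, Matrix.vecMulVec_apply, cv, Polynomial.eval_finset_sum]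

/-- If all inner products vanish, the vector is zero. -/
lemma zero_of_orth {K : Type*} [CommRing K] (w : Fin m → Fin d → K)
    (hiso : ∑ i, Matrix.vecMulVec (w i) (w i) = (1 : Matrix (Fin d) (Fin d) K))
    (u : Fin d → K) (h : ∀ i, w i ⬝ᵥ u = 0) : u = 0 := by
  have : (∑ i, Matrix.vecMulVec (w i) (w i)).mulVec u = u := by rw [hiso, Matrix.one_mulVec]
  rw [← this, Matrix.sum_mulVec]
  refine Finset.sum_eq_zero (fun i _ => ?_)
  rw [Matrix.vecMulVec_mulVec, h i]; simp

lemma ciso (v : Fin m → Fin d → ℝ)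
    (hiso : ∑ i : Fin m, Matrix.vecMulVec (v i) (v i) = (1 : Matrix (Fin d) (Fin d) ℝ)) :
    ∑ i, Matrix.vecMulVec (cv v i) (cv v i) = (1 : Matrix (Fin d) (Fin d) ℂ) := by
  ext a b
  have := congrFun (congrFun hiso a) b
  simp only [Matrix.sum_apply, Matrix.vecMulVec_apply] at this
  simp only [Matrix.sum_apply, Matrix.vecMulVec_apply, cv]
  have h2 : ((∑ c, v c a * v c b : ℝ) : ℂ) = ((1 : Matrix (Fin d) (Fin d) ℝ) a b : ℂ) := by rw [this]
  push_cast at h2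
  rw [h2]
  by_cases h : a = b
  · subst h; simp
  · simp [h]

lemma Hf_stable (v : Fin m → Fin d → ℝ)
    (hiso : ∑ i : Fin m, Matrix.vecMulVec (v i) (v i) = (1 : Matrix (Fin d) (Fin d) ℝ)) :
    FStable (Hf v) := by
  intro z hz hdet
  unfold Hf at hdet
  obtain ⟨u, hu, hu0⟩ := Matrix.exists_mulVec_eq_zero_iff.mpr hdet
  apply hu
  apply zero_of_orth (cv v) (ciso v hiso)
  have h1 : star u ⬝ᵥ ((∑ i, z i • Matrix.vecMulVec (cv v i) (cv v i)).mulVec u)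
      = ∑ i, z i * (Complex.normSq (cv v i ⬝ᵥ u) : ℂ) := by
    rw [Matrix.sum_mulVec, dotProduct_sum]
    refine Finset.sum_congr rfl (fun i _ => ?_)
    rw [Matrix.smul_mulVec, Matrix.vecMulVec_mulVec, dotProduct_smul, Complex.normSq_eq_conj_mul_self]
    have e : star u ⬝ᵥ cv v i = (starRingEnd ℂ) (cv v i ⬝ᵥ u) := by
      simp only [dotProduct, map_sum, map_mul]
      refine Finset.sum_congr rfl (fun k _ => ?_)
      simp [cv, mul_comm]
    simp only [smul_eq_mul, dotProduct_smul, MulOpposite.smul_eq_mul_unop, MulOpposite.unop_op, e]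
  rw [hu0, dotProduct_zero] at h1
  have h2 := congrArg Complex.im h1
  simp only [Complex.zero_im, Complex.im_sum, Complex.im_mul_ofReal] at h2
  have h3 := (Finset.sum_eq_zero_iff_of_nonneg (fun i _ =>
    mul_nonneg (hz i).le (Complex.normSq_nonneg (cv v i ⬝ᵥ u)))).mp h2.symm
  intro i
  have := h3 i (Finset.mem_univ i)
  rcases mul_eq_zero.mp this with h | h
  · exact absurd h (hz i).ne'
  · exact Complex.normSq_eq_zero.mp h

lemma Hf_rc (v : Fin m → Fin d → ℝ) (x : Fin m → ℝ) :
    Hf v (rc x) = ((∑ i, x i • Matrix.vecMulVec (v i) (v i)).det : ℝ) := by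
  unfold Hf
  have := RingHom.map_det Complex.ofRealHom (∑ i, x i • Matrix.vecMulVec (v i) (v i))
  rw [Complex.ofRealHom_eq_coe] at this
  rw [this]
  congr 1
  ext p q
  simp [Matrix.sum_apply, Matrix.vecMulVec_apply, cv, rc]

lemma real_det_pos (v : Fin m → Fin d → ℝ)
    (hiso : ∑ i : Fin m, Matrix.vecMulVec (v i) (v i) = (1 : Matrix (Fin d) (Fin d) ℝ))
    (x : Fin m → ℝ) (hx : ∀ i, 0 < x i) : 0 < (∑ i, x i • Matrix.vecMulVec (v i) (v i)).det := by
  apply Matrix.PosDef.det_pos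
  apply Matrix.PosDef.of_dotProduct_mulVec_pos
  · ext a b
    simp [Matrix.sum_apply, Matrix.vecMulVec_apply, mul_comm]
  · intro u hu
    have h1 : star u ⬝ᵥ ((∑ i, x i • Matrix.vecMulVec (v i) (v i)).mulVec u)
      = ∑ i, x i * (v i ⬝ᵥ u) ^ 2 := by
      rw [Matrix.sum_mulVec, dotProduct_sum]
      refine Finset.sum_congr rfl (fun i _ => ?_)
      rw [Matrix.smul_mulVec, Matrix.vecMulVec_mulVec, dotProduct_smul]
      simp only [smul_eq_mul, dotProduct_smul, MulOpposite.smul_eq_mul_unop, MulOpposite.unop_op,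
        star_trivial]
      rw [dotProduct_comm u (v i)]; ring
    rw [h1]
    have hnn : ∀ i ∈ Finset.univ, 0 ≤ x i * (v i ⬝ᵥ u) ^ 2 :=
      fun i _ => mul_nonneg (hx i).le (sq_nonneg _)
    rcases (Finset.sum_nonneg hnn).eq_or_lt with h | h
    · exfalso
      apply hu
      apply zero_of_orth v hiso
      intro i
      have := (Finset.sum_eq_zero_iff_of_nonneg hnn).mp h.symm i (Finset.mem_univ i)
      rcases mul_eq_zero.mp this with h | h
      · exact absurd h (hx i).ne'
      · exact pow_eq_zero_iff (two_ne_zero) |>.mp h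
    · exact h

lemma Hf_diag (v : Fin m → Fin d → ℝ)
    (hiso : ∑ i : Fin m, Matrix.vecMulVec (v i) (v i) = (1 : Matrix (Fin d) (Fin d) ℝ)) (t : ℂ) :
    Hf v (fun _ => t) = t ^ d := by
  unfold Hf
  rw [← Finset.smul_sum, ciso v hiso, Matrix.det_smul]; simp

lemma Hf_diag_add (v : Fin m → Fin d → ℝ)
    (hiso : ∑ i : Fin m, Matrix.vecMulVec (v i) (v i) = (1 : Matrix (Fin d) (Fin d) ℝ)) (t : ℂ)
    (ht : t ≠ 0) (i : Fin m) (s : ℂ) :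
    Hf v ((fun _ => t) + Pi.single i s) = t ^ d + s * (t ^ d * ((∑ j, v i j ^ 2 : ℝ) : ℂ) / t) := by
  unfold Hf
  rw [sum_add_single, ← Finset.smul_sum, ciso v hiso]
  have e : t • (1 : Matrix (Fin d) (Fin d) ℂ) + s • Matrix.vecMulVec (cv v i) (cv v i)
      = t • (1 + Matrix.replicateCol Unit ((s / t) • cv v i) * Matrix.replicateRow Unit (cv v i)) := by
    rw [← Matrix.vecMulVec_eq, smul_add]
    congr 1
    ext a b
    simp [Matrix.vecMulVec_apply]
    field_simp
  rw [e, Matrix.det_smul, Matrix.det_one_add_replicateCol_mul_replicateRow]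
  have e2 : cv v i ⬝ᵥ ((s / t) • cv v i) = (s / t) * ((∑ j, v i j ^ 2 : ℝ) : ℂ) := by
    rw [dotProduct_smul, smul_eq_mul]
    congr 1
    simp [dotProduct, cv, pow_two]
  rw [e2, Fintype.card_fin]
  field_simp

lemma Gf_diag (μ : Finset (Fin m) → ℝ) (c : ℕ) (hc : ∀ S, μ S ≠ 0 → S.card = c) (t : ℂ) :
    Gf μ (fun _ => t) = t ^ c * ((∑ S, μ S : ℝ) : ℂ) := by
  unfold Gf
  push_cast
  rw [Finset.mul_sum]
  refine Finset.sum_congr rfl (fun S _ => ?_)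
  by_cases h : μ S = 0
  · simp [h]
  · rw [Finset.prod_const, hc S h]; ring

lemma Gd_diag (μ : Finset (Fin m) → ℝ) (c : ℕ) (hc : ∀ S, μ S ≠ 0 → S.card = c) (t : ℂ)
    (ht : t ≠ 0) (i : Fin m) :
    Gd μ i (fun _ => t) = t ^ c *
      ((∑ S ∈ Finset.univ.filter (fun S : Finset (Fin m) => i ∈ S), μ S : ℝ) : ℂ) / t := by
  unfold Gd
  push_cast
  rw [Finset.sum_filter, Finset.mul_sum, Finset.sum_div]
  refine Finset.sum_congr rfl (fun S _ => ?_)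
  by_cases h : μ S = 0
  · simp [h]
  · split_ifs with hi
    · rw [Finset.prod_const, Finset.card_erase_of_mem hi, hc S h]
      have : 0 < c := by rw [← hc S h]; exact Finset.card_pos.mpr ⟨i, hi⟩
      obtain ⟨c', rfl⟩ : ∃ c', c = c' + 1 := ⟨c - 1, by omega⟩
      simp only [Nat.add_sub_cancel, pow_succ]
      field_simp
    · simp

/-- the product polynomial. -/
def FF (v : Fin m → Fin d → ℝ) (μ : Finset (Fin m) → ℝ) : (Fin m → ℂ) → ℂ :=
  fun z => Gf μ z * Hf v z

lemma FF_nice (v : Fin m → Fin d → ℝ) (μ : Finset (Fin m) → ℝ) : Nice (FF v μ) :=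
  (Gf_preNice μ).mul (Hf_preNice v)

lemma FF_stable (v : Fin m → Fin d → ℝ) (μ : Finset (Fin m) → ℝ)
    (hiso : ∑ i : Fin m, Matrix.vecMulVec (v i) (v i) = (1 : Matrix (Fin d) (Fin d) ℝ))
    (hS : FStable (Gf μ)) : FStable (FF v μ) :=
  fun z hz => mul_ne_zero (hS z hz) (Hf_stable v hiso z hz)

/-- mixed characteristic polynomial. -/
def PP (v : Fin m → Fin d → ℝ) (μ : Finset (Fin m) → ℝ) (x : ℝ) : ℝ :=
  val (opL (List.finRange m) (FF v μ)) (fun _ => x)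

theorem barrier_mix (v : Fin m → Fin d → ℝ) (μ : Finset (Fin m) → ℝ) (ε₁ ε₂ : ℝ)
    (hiso : ∑ i : Fin m, Matrix.vecMulVec (v i) (v i) = (1 : Matrix (Fin d) (Fin d) ℝ))
    (hnorm : ∀ i, ∑ j, v i j ^ 2 ≤ ε₂) (hS : FStable (Gf μ)) (hnn : ∀ S, 0 ≤ μ S)
    (hM : 0 < ∑ S, μ S) (c : ℕ) (hc : ∀ S, μ S ≠ 0 → S.card = c)
    (hmarg : ∀ i : Fin m,
      ∑ S ∈ Finset.univ.filter (fun S : Finset (Fin m) => i ∈ S), μ S ≤ ε₁ * ∑ S, μ S)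
    (hε : 0 < ε₁ + ε₂) (x : ℝ)
    (hx : 2 * Real.sqrt (2 * (ε₁ + ε₂) + (ε₁ + ε₂) ^ 2) ≤ x) : 0 < PP v μ x := by
  set ε := ε₁ + ε₂ with hεdef
  set t := Real.sqrt (2 * ε + ε ^ 2) with ht
  have htpos : 0 < t := Real.sqrt_pos.mpr (by positivity)
  have htsq : t ^ 2 = 2 * ε + ε ^ 2 := Real.sq_sqrt (by positivity)
  have htc : (t : ℂ) ≠ 0 := by exact_mod_cast htpos.ne'
  have hab : Above (FF v μ) (fun _ => t) := by
    intro y hy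
    have hy' : ∀ i, 0 < y i := fun i => lt_of_lt_of_le htpos (hy i)
    have hG : Gf μ (rc y) = ((∑ S, μ S * ∏ i ∈ S, y i : ℝ) : ℂ) := by
      simp [Gf, rc]
    have hGp : 0 < ∑ S, μ S * ∏ i ∈ S, y i := by
      obtain ⟨S, -, hSp⟩ := Finset.exists_lt_of_sum_lt (s := Finset.univ) (f := fun _ => (0 : ℝ)) (g := μ)
        (by simpa using hM)
      refine Finset.sum_pos' (fun S _ => mul_nonneg (hnn S) (Finset.prod_nonneg fun i _ => (hy' i).le))
        ⟨S, Finset.mem_univ S, mul_pos hSp (Finset.prod_pos fun i _ => hy' i)⟩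
    unfold val FF
    rw [hG, Hf_rc, ← Complex.ofReal_mul, Complex.ofReal_re]
    exact mul_pos hGp (real_det_pos v hiso y hy')
  have hphi : ∀ j, Phi (FF v μ) j (fun _ => t) ≤ ε / t := by
    intro j
    have e0 : rc (fun _ : Fin m => t) = fun _ => (t : ℂ) := rfl
    have e1 := Hf_diag v hiso (t : ℂ)
    have e2 := Gf_diag μ c hc (t : ℂ)
    have e3 := fD_mul (G := Gf μ) (H := Hf v) j (fun _ => (t : ℂ)) _ _
      (fun s => Gf_add_single μ _ j s) (fun s => by rw [Hf_diag_add v hiso t htc, e1])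
    rw [e1, e2, Gd_diag μ c hc t htc] at e3
    set M := ∑ S, μ S
    set a := ∑ S ∈ Finset.univ.filter (fun S : Finset (Fin m) => j ∈ S), μ S
    set b := ∑ k, v j k ^ 2
    have f1 : val (FF v μ) (fun _ => t) = t ^ c * M * t ^ d := by
      unfold val FF
      rw [e0, e1, e2]
      exact_mod_cast rfl
    have f2 : val (fD j (FF v μ)) (fun _ => t) = t ^ c * a / t * t ^ d + t ^ c * M * (t ^ d * b / t) := by
      unfold val FF
      rw [e0, e3]
      exact_mod_cast rfl
    unfold Phi
    rw [f1, f2, div_le_div_iff₀ (by positivity) htpos]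
    have e4 : (t ^ c * a / t * t ^ d + t ^ c * M * (t ^ d * b / t)) * t = (t ^ c * t ^ d) * (a + M * b) := by
      field_simp
    have e5 : ε * (t ^ c * M * t ^ d) = (t ^ c * t ^ d) * (ε * M) := by ring
    rw [e4, e5]
    apply mul_le_mul_of_nonneg_left _ (by positivity)
    have := hmarg j
    have h2 := mul_le_mul_of_nonneg_left (hnorm j) hM.le
    rw [hεdef]
    nlinarith
  have := barrier_all (FF_nice v μ) (FF_stable v μ hiso hS) hab (ε / t) t htpos hphi (by
    have : 2 * (ε / t) / t + (ε / t) ^ 2 = (2 * ε + ε ^ 2) / t ^ 2 := by field_simp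
    rw [this, htsq, div_self]
    positivity)
  exact this _ (fun i => by simp only; linarith)

end Concrete

/-! ### Interlacing / path argument -/

section Path

variable {m d : ℕ}

lemma fop_lin (i : Fin m) (F G : (Fin m → ℂ) → ℂ) (s : ℂ) :
    fop i (fun z => F z + s * G z) = fun z => fop i F z + s * fop i G z := by
  funext z
  simp only [fop, fD2]; ring

lemma opL_lin (L : List (Fin m)) (F G : (Fin m → ℂ) → ℂ) (s : ℂ) :
    opL L (fun z => F z + s * G z) = fun z => opL L F z + s * opL L G z := by
  induction L with
  | nil => rfl
  | cons a L ih =>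
    change fop a (opL L _) = _
    rw [ih, fop_lin]; rfl

lemma Gf_lin (μ ν : Finset (Fin m) → ℝ) (s : ℝ) (z : Fin m → ℂ) :
    Gf (fun S => μ S + s * ν S) z = Gf μ z + s * Gf ν z := by
  unfold Gf
  rw [Finset.mul_sum, ← Finset.sum_add_distrib]
  refine Finset.sum_congr rfl (fun S _ => ?_)
  push_cast; ring

lemma Gd_lin (μ ν : Finset (Fin m) → ℝ) (s : ℝ) (i : Fin m) (z : Fin m → ℂ) :
    Gd (fun S => μ S + s * ν S) i z = Gd μ i z + s * Gd ν i z := by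
  unfold Gd
  rw [Finset.mul_sum, ← Finset.sum_add_distrib]
  refine Finset.sum_congr rfl (fun S _ => ?_)
  push_cast; ring

lemma FF_lin (v : Fin m → Fin d → ℝ) (μ ν : Finset (Fin m) → ℝ) (s : ℝ) :
    FF v (fun S => μ S + s * ν S) = fun z => FF v μ z + s * FF v ν z := by
  funext z
  simp only [FF, Gf_lin]; ring

lemma PP_lin (v : Fin m → Fin d → ℝ) (μ ν : Finset (Fin m) → ℝ) (s : ℝ) (x : ℝ) :
    PP v (fun S => μ S + s * ν S) x = PP v μ x + s * PP v ν x := by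
  simp [PP, val, FF_lin, opL_lin]

lemma PP_zero (v : Fin m → Fin d → ℝ) (μ : Finset (Fin m) → ℝ) (h : ∀ S, μ S = 0) (x : ℝ) :
    PP v μ x = 0 := by
  have := PP_lin v μ μ 1 x
  have e : (fun S => μ S + 1 * μ S) = μ := by funext S; simp [h]
  rw [e] at this; linarith

lemma PP_cont (v : Fin m → Fin d → ℝ) (μ : Finset (Fin m) → ℝ) : Continuous (PP v μ) := by
  have h := (opL_nice (List.finRange m) (FF_nice v μ)).cont
  unfold PP val
  refine Complex.continuous_re.comp (h.comp ?_)
  unfold rc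
  fun_prop

lemma Gf_lim (μ ν : Finset (Fin m) → ℝ)
    (h : ∀ s : ℝ, 0 < s → s ≤ 1 → FStable (Gf (fun S => μ S + s * ν S)))
    (c : ℕ) (hc : ∀ S, μ S ≠ 0 → S.card = c) (hM : 0 < ∑ S, μ S) : FStable (Gf μ) := by
  have bound : ∀ z : Fin m → ℂ, (∀ i, 0 < (z i).im) → ∀ i t,
      ‖Gf μ (z + Pi.single i t)‖ ≤ (1 + ‖t‖ / (z i).im) * ‖Gf μ z‖ := by
    intro z hz i t
    have hs : ∀ s : ℝ, 0 < s → s ≤ 1 →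
        ‖Gf μ (z + Pi.single i t) + s * Gf ν (z + Pi.single i t)‖
          ≤ (1 + ‖t‖ / (z i).im) * ‖Gf μ z + s * Gf ν z‖ := by
      intro s hs0 hs1
      have := aff_bound (Gf (fun S => μ S + s * ν S) z) (Gd (fun S => μ S + s * ν S) i z) t
        (z i).im (hz i) (fun t ht => by
          rw [← Gf_add_single]
          exact h s hs0 hs1 _ (uhp_add_single hz i t ht))
      rwa [← Gf_add_single, Gf_lin, Gf_lin] at this
    have c1 : Continuous (fun s : ℝ => ‖Gf μ (z + Pi.single i t) + s * Gf ν (z + Pi.single i t)‖) := by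
      fun_prop
    have c2 : Continuous (fun s : ℝ => (1 + ‖t‖ / (z i).im) * ‖Gf μ z + s * Gf ν z‖) := by
      fun_prop
    have t1 := (c1.tendsto 0).mono_left (nhdsWithin_le_nhds (s := Set.Ioi (0 : ℝ)))
    have t2 := (c2.tendsto 0).mono_left (nhdsWithin_le_nhds (s := Set.Ioi (0 : ℝ)))
    have := le_of_tendsto_of_tendsto t1 t2 (by
      filter_upwards [Ioo_mem_nhdsGT (show (0 : ℝ) < 1 by norm_num)] with s hs'
      exact hs s hs'.1 hs'.2.le)
    simpa using this
  intro z hz h0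
  have key : ∀ s : Finset (Fin m), Gf μ (fun k => if k ∈ s then Complex.I else z k) = 0 := by
    intro s
    induction s using Finset.induction_on with
    | empty => simpa using h0
    | insert a s ha ih =>
      have hz' : ∀ i, 0 < ((fun k => if k ∈ s then Complex.I else z k : Fin m → ℂ) i).im := by
        intro i
        dsimp only
        split_ifs
        · simp
        · exact hz i
      have hb := bound _ hz' a (Complex.I - z a)
      rw [ih, norm_zero, mul_zero] at hb
      have e : (fun k => if k ∈ insert a s then Complex.I else z k) =
          (fun k => if k ∈ s then Complex.I else z k) + Pi.single a (Complex.I - z a) := by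
        funext k
        by_cases hk : k = a
        · subst hk; simp [ha]
        · simp [hk]
      rw [e]
      exact norm_le_zero_iff.mp hb
  have := key Finset.univ
  simp only [Finset.mem_univ, if_true] at this
  rw [Gf_diag μ c hc] at this
  have hM' : ((∑ S, μ S : ℝ) : ℂ) ≠ 0 := by exact_mod_cast hM.ne'
  exact mul_ne_zero (pow_ne_zero _ Complex.I_ne_zero) hM' this

lemma PP_mono (v : Fin m → Fin d → ℝ) (μ : Finset (Fin m) → ℝ)
    (hiso : ∑ i : Fin m, Matrix.vecMulVec (v i) (v i) = (1 : Matrix (Fin d) (Fin d) ℝ))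
    (hS : FStable (Gf μ)) {T : ℝ} (hT : ∀ x, T ≤ x → 0 < PP v μ x) {x : ℝ} (hx : T ≤ x) :
    PP v μ T ≤ PP v μ x :=
  diag_mono (opL_nice _ (FF_nice v μ)) (opL_stable _ (FF_nice v μ) (FF_stable v μ hiso hS)) hT hx

theorem path_lemma (v : Fin m → Fin d → ℝ) (μ ν : Finset (Fin m) → ℝ) (ε₂ : ℝ) (hε₂ : 0 ≤ ε₂)
    (hiso : ∑ i : Fin m, Matrix.vecMulVec (v i) (v i) = (1 : Matrix (Fin d) (Fin d) ℝ))
    (hnorm : ∀ i, ∑ j, v i j ^ 2 ≤ ε₂)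
    (hμ : ∀ S, 0 ≤ μ S) (hν : ∀ S, 0 ≤ ν S) (c : ℕ) (hcμ : ∀ S, μ S ≠ 0 → S.card = c)
    (hcν : ∀ S, ν S ≠ 0 → S.card = c)
    (h : ∀ s : ℝ, 0 < s → s ≤ 1 → FStable (Gf (fun S => μ S + s * ν S))) (T : ℝ)
    (hT : 0 < PP v μ T) (h1 : ∀ x, T ≤ x → 0 < PP v μ x + PP v ν x) :
    FStable (Gf μ) ∧ ∀ x, T ≤ x → 0 < PP v μ x := by
  have hM : 0 < ∑ S, μ S := by
    rcases (Finset.sum_nonneg (fun S _ => hμ S) : 0 ≤ ∑ S, μ S).lt_or_eq with h | h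
    · exact h
    · exfalso
      have := (Finset.sum_eq_zero_iff_of_nonneg (fun S _ => hμ S)).mp h.symm
      rw [PP_zero v μ (fun S => this S (Finset.mem_univ S))] at hT
      exact lt_irrefl _ hT
  refine ⟨Gf_lim μ ν h c hcμ hM, ?_⟩
  set c0 := min (PP v μ T) (PP v μ T + PP v ν T) with hc0
  have hc0p : 0 < c0 := lt_min hT (h1 T le_rfl)
  -- value at T
  have hvalT : ∀ s : ℝ, 0 ≤ s → s ≤ 1 → c0 ≤ PP v μ T + s * PP v ν T := by
    intro s hs0 hs1
    have a1 : c0 ≤ PP v μ T := min_le_left _ _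
    have a2 : c0 ≤ PP v μ T + PP v ν T := min_le_right _ _
    nlinarith
  set X0 := 2 * Real.sqrt (2 * (1 + ε₂) + (1 + ε₂) ^ 2) with hX0
  have hbig : ∀ s : ℝ, 0 < s → s ≤ 1 → ∀ x, X0 ≤ x → 0 < PP v μ x + s * PP v ν x := by
    intro s hs0 hs1 x hx
    rw [← PP_lin]
    have hnn' : ∀ S, 0 ≤ μ S + s * ν S := fun S => add_nonneg (hμ S) (mul_nonneg hs0.le (hν S))
    refine barrier_mix v _ 1 ε₂ hiso hnorm (h s hs0 hs1) hnn' ?_ c ?_ ?_ (by linarith) x hx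
    · refine lt_of_lt_of_le hM (Finset.sum_le_sum fun S _ => ?_)
      have := mul_nonneg hs0.le (hν S); linarith
    · intro S hS
      by_cases hm : μ S = 0
      · refine hcν S (fun hn => hS ?_)
        simp [hm, hn]
      · exact hcμ S hm
    · intro i
      rw [one_mul]
      exact Finset.sum_le_sum_of_subset_of_nonneg (Finset.filter_subset _ _) (fun S _ _ => hnn' S)
  obtain ⟨M, hMb⟩ := (isCompact_Icc (a := T) (b := X0)).exists_bound_of_continuousOn
    (PP_cont v ν).continuousOn
  set M' := max M 1 with hM'
  have hM'p : 0 < M' := lt_of_lt_of_le one_pos (le_max_right _ _)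
  set η := c0 / (2 * M') with hη
  have hηp : 0 < η := by positivity
  have hηM : η * M' < c0 := by
    rw [hη]; field_simp; linarith
  have hlow : ∀ s : ℝ, 0 < s → s ≤ 1 → (∀ x, T ≤ x → 0 < PP v μ x + s * PP v ν x) →
      ∀ x, T ≤ x → c0 ≤ PP v μ x + s * PP v ν x := by
    intro s hs0 hs1 hp x hx
    refine (hvalT s hs0.le hs1).trans ?_
    rw [← PP_lin, ← PP_lin]
    exact PP_mono v _ hiso (h s hs0 hs1) (fun y hy => by rw [PP_lin]; exact hp y hy) hx
  have hdesc : ∀ n : ℕ, ∀ s : ℝ, 0 < s → s ≤ 1 → 1 - n * η ≤ s →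
      ∀ x, T ≤ x → 0 < PP v μ x + s * PP v ν x := by
    intro n
    induction n with
    | zero =>
      intro s hs0 hs1 hs x hx
      have : s = 1 := by simp at hs; linarith
      rw [this, one_mul]; exact h1 x hx
    | succ n ih =>
      intro s hs0 hs1 hs x hx
      by_cases hxX : X0 ≤ x
      · exact hbig s hs0 hs1 x hxX
      · push Not at hxX
        set s' := min 1 (s + η) with hs'
        have hs'0 : 0 < s' := lt_min one_pos (by linarith)
        have hs'1 : s' ≤ 1 := min_le_left _ _
        have hss : s ≤ s' := le_min hs1 (by linarith)
        have hss2 : s' ≤ s + η := min_le_right _ _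
        have hs'n : 1 - n * η ≤ s' := by
          refine le_min ?_ ?_
          · have : 0 ≤ n * η := by positivity
            linarith
          · push_cast at hs; linarith
        have hl := hlow s' hs'0 hs'1 (ih s' hs'0 hs'1 hs'n) x hx
        have hb := hMb x ⟨hx, hxX.le⟩
        rw [Real.norm_eq_abs] at hb
        have hb' : PP v ν x ≤ M' := (le_abs_self _).trans (hb.trans (le_max_left _ _))
        have : (s' - s) * PP v ν x ≤ η * M' := by
          calc (s' - s) * PP v ν x ≤ (s' - s) * M' :=
                mul_le_mul_of_nonneg_left hb' (by linarith)
            _ ≤ η * M' := mul_le_mul_of_nonneg_right (by linarith) hM'p.le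
        nlinarith
  have hall : ∀ s : ℝ, 0 < s → s ≤ 1 → ∀ x, T ≤ x → c0 ≤ PP v μ x + s * PP v ν x := by
    intro s hs0 hs1
    refine hlow s hs0 hs1 ?_
    obtain ⟨n, hn⟩ := exists_nat_gt (1 / η)
    refine hdesc n s hs0 hs1 ?_
    rw [div_lt_iff₀ hηp] at hn
    linarith
  intro x hx
  have cc : Continuous (fun s : ℝ => PP v μ x + s * PP v ν x) := by fun_prop
  have t1 := (cc.tendsto 0).mono_left (nhdsWithin_le_nhds (s := Set.Ioi (0 : ℝ)))
  have := ge_of_tendsto t1 (b := c0) (by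
    filter_upwards [Ioo_mem_nhdsGT (show (0 : ℝ) < 1 by norm_num)] with s hs'
    exact hall s hs'.1 hs'.2.le x hx)
  simp only [zero_mul, add_zero] at this
  linarith

/-- reweighting keeps stability. -/
lemma Gf_reweight (μ : Finset (Fin m) → ℝ) (hS : FStable (Gf μ)) (i : Fin m) (a b : ℝ)
    (ha : 0 < a) (hb : 0 < b) :
    FStable (Gf (fun S => if i ∈ S then a * μ S else b * μ S)) := by
  intro z hz h0
  have hbc : (b : ℂ) ≠ 0 := by exact_mod_cast hb.ne'
  set w : Fin m → ℂ := fun k => if k = i then ((a / b : ℝ) : ℂ) * z k else z k with hw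
  have hwim : ∀ k, 0 < (w k).im := by
    intro k
    simp only [hw]
    split_ifs
    · rw [Complex.im_ofReal_mul]; exact mul_pos (div_pos ha hb) (hz k)
    · exact hz k
  apply hS w hwim
  have : Gf (fun S => if i ∈ S then a * μ S else b * μ S) z = b * Gf μ w := by
    unfold Gf
    rw [Finset.mul_sum]
    refine Finset.sum_congr rfl (fun S _ => ?_)
    by_cases hi : i ∈ S
    · have : ∏ k ∈ S, w k = ((a / b : ℝ) : ℂ) * ∏ k ∈ S, z k := by
        rw [← Finset.mul_prod_erase S _ hi, ← Finset.mul_prod_erase S z hi]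
        have e : ∏ k ∈ S.erase i, w k = ∏ k ∈ S.erase i, z k :=
          Finset.prod_congr rfl (fun k hk => by simp [hw, Finset.ne_of_mem_erase hk])
        rw [e]; simp [hw]; ring
      rw [this]; simp [hi]; field_simp
    · have : ∏ k ∈ S, w k = ∏ k ∈ S, z k :=
        Finset.prod_congr rfl (fun k hk => by
          have : k ≠ i := fun h => hi (h ▸ hk)
          simp [hw, this])
      rw [this]; simp [hi]; ring
  rw [this] at h0
  exact (mul_eq_zero.mp h0).resolve_left hbc

lemma step_lemma (v : Fin m → Fin d → ℝ) (μ : Finset (Fin m) → ℝ) (ε₂ : ℝ) (hε₂ : 0 ≤ ε₂)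
    (hiso : ∑ i : Fin m, Matrix.vecMulVec (v i) (v i) = (1 : Matrix (Fin d) (Fin d) ℝ))
    (hnorm : ∀ i, ∑ j, v i j ^ 2 ≤ ε₂)
    (hμ : ∀ S, 0 ≤ μ S) (c : ℕ) (hc : ∀ S, μ S ≠ 0 → S.card = c)
    (hS : FStable (Gf μ)) (T : ℝ) (hT : ∀ x, T ≤ x → 0 < PP v μ x) (i : Fin m) :
    ∃ p : Prop, ∃ ν : Finset (Fin m) → ℝ, (∀ S, (i ∈ S ↔ p) → ν S = μ S) ∧
      (∀ S, ¬ (i ∈ S ↔ p) → ν S = 0) ∧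
      FStable (Gf ν) ∧ ∀ x, T ≤ x → 0 < PP v ν x := by
  set μ1 : Finset (Fin m) → ℝ := fun S => if i ∈ S then μ S else 0 with h1
  set μ0 : Finset (Fin m) → ℝ := fun S => if i ∈ S then 0 else μ S with h0
  have e1 : (fun S => μ1 S + 1 * μ0 S) = μ := by
    funext S; simp only [h1, h0]; split_ifs <;> simp
  have hadd : ∀ x, PP v μ1 x + PP v μ0 x = PP v μ x := by
    intro x
    have := PP_lin v μ1 μ0 1 x
    rw [e1] at this; linarith
  have n1 : ∀ S, 0 ≤ μ1 S := fun S => by simp only [h1]; split_ifs; exacts [hμ S, le_rfl]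
  have n0 : ∀ S, 0 ≤ μ0 S := fun S => by simp only [h0]; split_ifs; exacts [le_rfl, hμ S]
  have c1 : ∀ S, μ1 S ≠ 0 → S.card = c := fun S h => hc S (fun e => h (by simp [h1, e]))
  have c0 : ∀ S, μ0 S ≠ 0 → S.card = c := fun S h => hc S (fun e => h (by simp [h0, e]))
  by_cases hp : 0 < PP v μ1 T
  · refine ⟨True, μ1, fun S h => by simp [h1, h.mpr trivial], fun S h => ?_, ?_⟩
    · have : i ∉ S := fun hi => h (by simp [hi])
      simp [h1, this]
    · refine path_lemma v μ1 μ0 ε₂ hε₂ hiso hnorm n1 n0 c c1 c0 (fun s hs0 _ => ?_) T hp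
        (fun x hx => by rw [hadd]; exact hT x hx)
      convert Gf_reweight μ hS i 1 s one_pos hs0 using 3 with S
      simp only [h1, h0]; split_ifs <;> simp
  · have hp0 : 0 < PP v μ0 T := by
      have := hadd T; have := hT T le_rfl; linarith
    refine ⟨False, μ0, fun S h => ?_, fun S h => ?_, ?_⟩
    · have : i ∉ S := fun hi => h.mp hi
      simp [h0, this]
    · have : i ∈ S := by by_contra hi; exact h (by simp [hi])
      simp [h0, this]
    · refine path_lemma v μ0 μ1 ε₂ hε₂ hiso hnorm n0 n1 c c0 c1 (fun s hs0 _ => ?_) T hp0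
        (fun x hx => by rw [add_comm, hadd]; exact hT x hx)
      convert Gf_reweight μ hS i s 1 hs0 one_pos using 3 with S
      simp only [h1, h0]; split_ifs <;> simp

theorem exists_leaf (v : Fin m → Fin d → ℝ) (μ : Finset (Fin m) → ℝ) (ε₂ : ℝ) (hε₂ : 0 ≤ ε₂)
    (hiso : ∑ i : Fin m, Matrix.vecMulVec (v i) (v i) = (1 : Matrix (Fin d) (Fin d) ℝ))
    (hnorm : ∀ i, ∑ j, v i j ^ 2 ≤ ε₂)
    (hμ : ∀ S, 0 ≤ μ S) (c : ℕ) (hc : ∀ S, μ S ≠ 0 → S.card = c)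
    (hS : FStable (Gf μ)) (T : ℝ) (hT : ∀ x, T ≤ x → 0 < PP v μ x) :
    ∃ S0 : Finset (Fin m), 0 < μ S0 ∧
      ∀ x, T ≤ x → 0 < PP v (fun S => if S = S0 then μ S else 0) x := by
  classical
  have key : ∀ s : Finset (Fin m), ∃ S0 : Finset (Fin m),
      FStable (Gf (fun S => if ∀ i ∈ s, (i ∈ S ↔ i ∈ S0) then μ S else 0)) ∧
      ∀ x, T ≤ x → 0 < PP v (fun S => if ∀ i ∈ s, (i ∈ S ↔ i ∈ S0) then μ S else 0) x := by
    intro s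
    induction s using Finset.induction_on with
    | empty => exact ⟨∅, by simpa using hS, by simpa using hT⟩
    | insert a s ha ih =>
      obtain ⟨S0, hst, hpos⟩ := ih
      obtain ⟨p, ν, hν1, hν0, hνs, hνp⟩ := step_lemma v
        (fun S => if ∀ i ∈ s, (i ∈ S ↔ i ∈ S0) then μ S else 0) ε₂ hε₂ hiso hnorm
        (fun S => by split_ifs; exacts [hμ S, le_rfl]) c
        (fun S h => hc S (fun e => h (by simp [e]))) hst T hpos a
      have hex : ∃ S1 : Finset (Fin m), (∀ i ∈ s, (i ∈ S1 ↔ i ∈ S0)) ∧ (a ∈ S1 ↔ p) := by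
        by_cases hp : p
        · refine ⟨insert a S0, fun i hi => ?_, by simp [hp]⟩
          have : i ≠ a := fun h => ha (h ▸ hi)
          simp [this]
        · refine ⟨S0.erase a, fun i hi => ?_, by simp [hp]⟩
          have : i ≠ a := fun h => ha (h ▸ hi)
          simp [this]
      obtain ⟨S1, hS1, hS1p⟩ := hex
      have e : (fun S => if ∀ i ∈ insert a s, (i ∈ S ↔ i ∈ S1) then μ S else 0) = ν := by
        funext S
        by_cases hap : a ∈ S ↔ p
        · rw [hν1 S hap]
          congr 1
          simp only [Finset.forall_mem_insert, eq_iff_iff]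
          constructor
          · rintro ⟨-, h⟩ i hi
            rw [h i hi, hS1 i hi]
          · intro h
            exact ⟨by rw [hap, hS1p], fun i hi => by rw [h i hi, hS1 i hi]⟩
        · rw [hν0 S hap, if_neg]
          intro h
          apply hap
          rw [h a (Finset.mem_insert_self _ _), hS1p]
      refine ⟨S1, ?_, ?_⟩
      · rw [e]; exact hνs
      · rw [e]; exact hνp
  obtain ⟨S0, -, hpos⟩ := key Finset.univ
  have e : (fun S => if ∀ i ∈ (Finset.univ : Finset (Fin m)), (i ∈ S ↔ i ∈ S0) then μ S else 0)
      = (fun S => if S = S0 then μ S else 0) := by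
    funext S
    congr 1
    simp [Finset.ext_iff]
  rw [e] at hpos
  refine ⟨S0, ?_, hpos⟩
  rcases (hμ S0).lt_or_eq with h | h
  · exact h
  · exfalso
    have := hpos T le_rfl
    rw [PP_zero v _ (fun S => by
      split_ifs with hs
      · rw [hs, ← h]
      · rfl)] at this
    exact lt_irrefl _ this

end Path

/-! ### The final formula -/

section Final

variable {m d : ℕ}

lemma opL_form (v : Fin m → Fin d → ℝ) (S : Finset (Fin m)) (b : ℂ) (L : List (Fin m))
    (hL : L.Nodup) : ∀ z : Fin m → ℂ, (∀ k ∈ L, z k ≠ 0) →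
    opL L (fun z => (b * ∏ i ∈ S, z i) * Hf v z) z =
      (b * ∏ i ∈ S, z i) * Hf v (fun k => if k ∈ L ∧ k ∈ S then z k - 2 / z k else z k) := by
  induction L with
  | nil => intro z _; simp [opL]
  | cons a L ih =>
    intro z hz
    rw [List.nodup_cons] at hL
    obtain ⟨haL, hLn⟩ := hL
    set w : Fin m → ℂ := fun k => if k ∈ L ∧ k ∈ S then z k - 2 / z k else z k with hw
    have hne : ∀ k ∈ L, k ≠ a := fun k hk h => haL (h ▸ hk)
    have hsh : ∀ t : ℂ, opL L (fun z => (b * ∏ i ∈ S, z i) * Hf v z) (z + Pi.single a t) =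
        (b * ∏ i ∈ S, (z + Pi.single a t : Fin m → ℂ) i) * Hf v (w + Pi.single a t) := by
      intro t
      have hcond : ∀ k ∈ L, (z + Pi.single a t : Fin m → ℂ) k ≠ 0 := fun k hk => by
        simpa [hne k hk] using hz k (List.mem_cons_of_mem _ hk)
      refine (ih hLn _ hcond).trans ?_
      congr 2
      funext k
      by_cases hk : k = a
      · subst hk; simp [hw, haL]
      · simp [hw, hk]
    have hs0 : opL L (fun z => (b * ∏ i ∈ S, z i) * Hf v z) z =
        (b * ∏ i ∈ S, z i) * Hf v w := by
      have := hsh 0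
      simpa using this
    obtain ⟨c', hc'⟩ := (Hf_preNice v).aff a w
    change fop a (opL L _) z = _
    simp only [fop, fD2, hsh, hs0, prod_add_single, hc']
    by_cases haS : a ∈ S
    · have hza : z a ≠ 0 := hz a (by simp)
      have e : (fun k => if k ∈ a :: L ∧ k ∈ S then z k - 2 / z k else z k)
          = w + Pi.single a (-2 / z a) := by
        funext k
        by_cases hk : k = a
        · subst hk; simp [hw, haL, haS]; ring
        · simp [hw, hk]
      rw [e, hc', ← Finset.mul_prod_erase S z haS]
      simp only [haS, if_true]
      field_simp
      ring
    · have e : (fun k => if k ∈ a :: L ∧ k ∈ S then z k - 2 / z k else z k) = w := by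
        funext k
        by_cases hk : k = a
        · subst hk; simp [hw, haS]
        · simp [hw, hk]
      rw [e]
      simp only [haS, if_false]
      ring

lemma PP_leaf (v : Fin m → Fin d → ℝ)
    (hiso : ∑ i : Fin m, Matrix.vecMulVec (v i) (v i) = (1 : Matrix (Fin d) (Fin d) ℝ))
    (μ : Finset (Fin m) → ℝ) (S0 : Finset (Fin m))
    (x : ℝ) (hx : 0 < x)
    (hP : 0 < PP v (fun S => if S = S0 then μ S else 0) x) :
    (x • (1 : Matrix (Fin d) (Fin d) ℝ)
      - (2 / x) • ∑ i ∈ S0, Matrix.vecMulVec (v i) (v i)).det ≠ 0 := by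
  intro hdet
  have hF : FF v (fun S => if S = S0 then μ S else 0)
      = fun z => ((μ S0 : ℂ) * ∏ i ∈ S0, z i) * Hf v z := by
    funext z
    unfold FF
    congr 1
    unfold Gf
    rw [Finset.sum_eq_single S0]
    · simp
    · intro S _ hS; simp [hS]
    · simp
  have hval := (opL_nice (List.finRange m)
    (FF_nice v (fun S => if S = S0 then μ S else 0))).val_eq (fun _ => x)
  have hxc : (x : ℂ) ≠ 0 := by exact_mod_cast hx.ne'
  rw [hF, opL_form v S0 _ _ (List.nodup_finRange m) _ (fun k _ => by simpa [rc] using hx.ne')] at hval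
  have e : (fun k => if k ∈ List.finRange m ∧ k ∈ S0 then rc (fun _ => x) k - 2 / rc (fun _ => x) k
      else rc (fun _ => x) k) = rc (m := m) (fun k => x - if k ∈ S0 then 2 / x else 0) := by
    funext k
    by_cases hk : k ∈ S0 <;> simp [rc, hk]
  rw [e, Hf_rc] at hval
  have e2 : ∑ i, (x - if i ∈ S0 then 2 / x else 0) • Matrix.vecMulVec (v i) (v i)
      = x • (1 : Matrix (Fin d) (Fin d) ℝ)
      - (2 / x) • ∑ i ∈ S0, Matrix.vecMulVec (v i) (v i) := by
    simp only [sub_smul, Finset.sum_sub_distrib, ← Finset.smul_sum, hiso]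
    congr 1
    simp only [ite_smul, zero_smul, Finset.sum_ite_mem, Finset.univ_inter, Finset.smul_sum]
  rw [e2, hdet] at hval
  simp only [Complex.ofReal_zero, mul_zero] at hval
  have h0 : PP v (fun S => if S = S0 then μ S else 0) x = 0 := by
    unfold PP
    rw [hF]
    exact_mod_cast hval.symm
  linarith

lemma psd_of_det (A : Matrix (Fin d) (Fin d) ℝ) (hA : A.IsHermitian) (T : ℝ) (hT : 0 < T)
    (h : ∀ x, T ≤ x → (x • (1 : Matrix (Fin d) (Fin d) ℝ) - (2 / x) • A).det ≠ 0) :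
    ((T ^ 2 / 2) • (1 : Matrix (Fin d) (Fin d) ℝ) - A).PosSemidef := by
  have hH : ((T ^ 2 / 2) • (1 : Matrix (Fin d) (Fin d) ℝ) - A).IsHermitian := by
    apply Matrix.IsHermitian.sub _ hA
    unfold Matrix.IsHermitian
    simp [Matrix.conjTranspose_smul]
  rw [hH.posSemidef_iff_eigenvalues_nonneg]
  intro i
  by_contra hneg
  have hneg : hH.eigenvalues i < 0 := by simpa using hneg
  set ν := hH.eigenvalues i with hν
  have hev := hH.mulVec_eigenvectorBasis i
  set u : Fin d → ℝ := (hH.eigenvectorBasis i).ofLp with hu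
  have hu0 : u ≠ 0 := by
    intro h0
    apply hH.eigenvectorBasis.orthonormal.ne_zero i
    ext k
    exact congrFun h0 k
  rw [← hν, Matrix.sub_mulVec, Matrix.smul_mulVec, Matrix.one_mulVec] at hev
  have hAu : A.mulVec u = (T ^ 2 / 2 - ν) • u := by
    rw [sub_smul, ← hev]; abel
  set x := Real.sqrt (2 * (T ^ 2 / 2 - ν)) with hx
  have hxsq : x ^ 2 = 2 * (T ^ 2 / 2 - ν) := Real.sq_sqrt (by nlinarith)
  have hTx : T ≤ x := Real.le_sqrt_of_sq_le (by linarith)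
  have hx0 : x ≠ 0 := by linarith
  apply h x hTx
  rw [← Matrix.exists_mulVec_eq_zero_iff]
  refine ⟨u, hu0, ?_⟩
  rw [Matrix.sub_mulVec, Matrix.smul_mulVec, Matrix.smul_mulVec, Matrix.one_mulVec, hAu, smul_smul,
    ← sub_smul]
  have : x - 2 / x * (T ^ 2 / 2 - ν) = 0 := by
    field_simp; linarith
  rw [this, zero_smul]

end Final

/-- Main theorem: for a homogeneous strongly Rayleigh distribution with marginals at most `ε₁`
and isotropic vectors of squared norm at most `ε₂`, there is a set `S` of positive probability
with `Σ_{i∈S} v_i v_iᵀ ⪯ (4ε + 2ε²)·I` where `ε = ε₁ + ε₂`. -/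
theorem stmt0 {m d : ℕ} (μ : Finset (Fin m) → ℝ) (ε₁ ε₂ : ℝ)
    (v : Fin m → Fin d → ℝ)
    (hnn : ∀ S, 0 ≤ μ S)
    (hsum : ∑ S : Finset (Fin m), μ S = 1)
    (hhom : ∃ c : ℕ, ∀ S, 0 < μ S → S.card = c)
    (hSR : RealStable (genPoly μ))
    (hmarg : ∀ i : Fin m,
      ∑ S ∈ Finset.univ.filter (fun S : Finset (Fin m) => i ∈ S), μ S ≤ ε₁)
    (hiso : ∑ i : Fin m, Matrix.vecMulVec (v i) (v i) = (1 : Matrix (Fin d) (Fin d) ℝ))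
    (hnorm : ∀ i, ∑ j, v i j ^ 2 ≤ ε₂) :
    ∃ S : Finset (Fin m), 0 < μ S ∧
      Matrix.PosSemidef
        ((4 * (ε₁ + ε₂) + 2 * (ε₁ + ε₂) ^ 2) • (1 : Matrix (Fin d) (Fin d) ℝ)
          - ∑ i ∈ S, Matrix.vecMulVec (v i) (v i)) := by
  classical
  obtain ⟨c, hc⟩ := hhom
  have hc' : ∀ S, μ S ≠ 0 → S.card = c := fun S h => hc S (lt_of_le_of_ne (hnn S) (Ne.symm h))
  rcases Nat.eq_zero_or_pos d with hd | hd
  · subst hd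
    obtain ⟨S, -, hSp⟩ := Finset.exists_lt_of_sum_lt (s := Finset.univ) (f := fun _ => (0 : ℝ))
      (g := μ) (by simp [hsum])
    refine ⟨S, hSp, ?_⟩
    rw [Subsingleton.elim ((4 * (ε₁ + ε₂) + 2 * (ε₁ + ε₂) ^ 2) • (1 : Matrix (Fin 0) (Fin 0) ℝ)
          - ∑ i ∈ S, Matrix.vecMulVec (v i) (v i)) 0]
    exact Matrix.PosSemidef.zero
  · have hex : ∃ i, v i ≠ 0 := by
      by_contra hcon
      push Not at hcon
      have h00 := congrFun (congrFun hiso ⟨0, hd⟩) ⟨0, hd⟩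
      simp [hcon] at h00
    obtain ⟨i0, hi0⟩ := hex
    have hε₂ : 0 < ε₂ := by
      refine lt_of_lt_of_le ?_ (hnorm i0)
      obtain ⟨j, hj⟩ := Function.ne_iff.mp hi0
      have hj' : v i0 j ≠ 0 := hj
      exact Finset.sum_pos' (fun k _ => sq_nonneg _) ⟨j, Finset.mem_univ j, by positivity⟩
    have hε₁ : 0 ≤ ε₁ := le_trans (Finset.sum_nonneg fun S _ => hnn S) (hmarg i0)
    have hε : 0 < ε₁ + ε₂ := by linarith
    have hSt : FStable (Gf μ) := by
      intro z hz h0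
      apply hSR z hz
      rw [← h0]
      simp [genPoly, Gf]
    set T := 2 * Real.sqrt (2 * (ε₁ + ε₂) + (ε₁ + ε₂) ^ 2) with hT
    have hTpos : 0 < T := mul_pos two_pos (Real.sqrt_pos.mpr (by positivity))
    have hTsq : T ^ 2 / 2 = 4 * (ε₁ + ε₂) + 2 * (ε₁ + ε₂) ^ 2 := by
      rw [hT, mul_pow, Real.sq_sqrt (by positivity)]; ring
    obtain ⟨S0, hS0, hpos⟩ := exists_leaf v μ ε₂ hε₂.le hiso hnorm hnn c hc' hSt T
      (fun x hx => barrier_mix v μ ε₁ ε₂ hiso hnorm hSt hnn (by rw [hsum]; exact one_pos) c hc'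
        (fun i => by rw [hsum, mul_one]; exact hmarg i) hε x hx)
    refine ⟨S0, hS0, ?_⟩
    rw [← hTsq]
    refine psd_of_det _ ?_ T hTpos (fun x hx =>
      PP_leaf v hiso μ S0 x (lt_of_lt_of_le hTpos hx) (hpos x hx))
    unfold Matrix.IsHermitian
    ext a b
    simp [Matrix.sum_apply, Matrix.vecMulVec_apply, mul_comm]
end
end

section
/- Let v_1,...,v_m ∈ ℝ^d satisfy Σ_{i=1}^m v_i v_iᵀ = I and ‖v_i‖² ≤ ε for all i. Then for every positive integer r there is a partition of [m] into sets S_1,...,S_r such that for every j ≤ r, ‖Σ_{i∈S_j} v_i v_iᵀ‖ ≤ 4(1/r + ε) + 2(1/r + ε)². -/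
noncomputable section
open Polynomial ComplexConjugate in
lemma ks_im_lt (a b : ℂ) (h : ∀ s : ℂ, 0 ≤ s.im → a + s * b ≠ 0) :
    b = 0 ∨ (b * conj a).im < 0 := by
  by_cases hb : b = 0
  · exact Or.inl hb
  right
  by_contra hcon
  push Not at hcon
  refine h (-(a * conj b) / (Complex.normSq b : ℂ)) ?_ ?_
  · rw [Complex.div_ofReal_im]
    apply div_nonneg _ (Complex.normSq_nonneg b)
    simp only [Complex.mul_im, Complex.conj_re, Complex.conj_im, Complex.neg_im] at hcon ⊢
    linarith
  · have hn : (Complex.normSq b : ℂ) ≠ 0 := by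
      exact_mod_cast (Complex.normSq_pos.2 hb).ne'
    field_simp
    have : b * conj b = Complex.normSq b := Complex.mul_conj b
    linear_combination (-a) * this

open Polynomial ComplexConjugate in
lemma ks_im_le (a b : ℂ) (h : ∀ s : ℂ, 0 ≤ s.im → a + s * b ≠ 0) :
    (b * conj a).im ≤ 0 := by
  rcases ks_im_lt a b h with h | h
  · simp [h]
  · exact h.le

open Polynomial ComplexConjugate in
lemma ks_angle (A1 B : ℝ[X]) (a : ℝ) (k : ℕ)
    (h : ∀ t : ℂ, 0 < t.im → (aeval t B * conj (aeval t ((X - C a) ^ k * A1))).im ≤ 0)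
    (θ : ℝ) (h0 : 0 < θ) (h1 : θ < Real.pi) :
    0 ≤ B.eval a * A1.eval a * Real.sin (k * θ) := by
  set e : ℂ := Complex.exp (θ * Complex.I) with he
  have him : e.im = Real.sin θ := Complex.exp_ofReal_mul_I_im θ
  have hpos : 0 < e.im := by rw [him]; exact Real.sin_pos_of_pos_of_lt_pi h0 h1
  have hek : e ^ k = Complex.exp (((k * θ : ℝ) : ℂ) * Complex.I) := by
    rw [he, ← Complex.exp_nat_mul]; push_cast; ring_nf
  let g : ℝ → ℝ := fun ρ => (aeval ((a : ℂ) + ρ * e) B * conj (aeval ((a : ℂ) + ρ * e) A1)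
    * conj (e ^ k)).im
  have hg : Continuous g := by
    have h1 : ∀ p : ℝ[X], Continuous fun ρ : ℝ => aeval ((a : ℂ) + ρ * e) p := by
      intro p
      exact (Polynomial.continuous_aeval p).comp (by fun_prop)
    have := h1 B
    have := h1 A1
    have hc : Continuous (fun z : ℂ => conj z) := Complex.continuous_conj
    exact Complex.continuous_im.comp (((h1 B).mul (hc.comp (h1 A1))).mul continuous_const)
  have hle : ∀ ρ : ℝ, 0 < ρ → g ρ ≤ 0 := by
    intro ρ hρ
    have h2 := h ((a : ℂ) + ρ * e) (by simp; positivity)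
    have : aeval ((a : ℂ) + ρ * e) B * conj (aeval ((a : ℂ) + ρ * e) ((X - C a) ^ k * A1))
      = ((ρ ^ k : ℝ) : ℂ) * (aeval ((a : ℂ) + ρ * e) B * conj (aeval ((a : ℂ) + ρ * e) A1)
          * conj (e ^ k)) := by
      simp only [map_mul, map_pow, map_sub, aeval_X, aeval_C, Complex.coe_algebraMap,
        add_sub_cancel_left, Complex.conj_ofReal, mul_pow]
      push_cast
      ring
    rw [this, Complex.im_ofReal_mul] at h2
    exact nonpos_of_mul_nonpos_right h2 (by positivity)
  have h3 : g 0 ≤ 0 := by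
    have ht : Filter.Tendsto g (nhdsWithin 0 (Set.Ioi 0)) (nhds (g 0)) :=
      hg.continuousAt.tendsto.mono_left nhdsWithin_le_nhds
    exact le_of_tendsto ht (Filter.eventually_of_mem self_mem_nhdsWithin hle)
  have h4 : g 0 = -(B.eval a * A1.eval a * Real.sin (k * θ)) := by
    have hr : ∀ p : ℝ[X], aeval (a : ℂ) p = ((p.eval a : ℝ) : ℂ) := by
      intro p
      exact (Polynomial.aeval_algebraMap_apply_eq_algebraMap_eval a p)
    simp only [g, Complex.ofReal_zero, zero_mul, add_zero, hr, Complex.conj_ofReal]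
    rw [← Complex.ofReal_mul, Complex.im_ofReal_mul, Complex.conj_im, hek,
      Complex.exp_ofReal_mul_I_im]
    ring
  linarith

open Polynomial ComplexConjugate in
lemma ks_simple (A1 B : ℝ[X]) (a : ℝ) (k : ℕ) (hk : 1 ≤ k)
    (h : ∀ t : ℂ, 0 < t.im → (aeval t B * conj (aeval t ((X - C a) ^ k * A1))).im ≤ 0)
    (hA : A1.eval a ≠ 0) (hB : B.eval a ≠ 0) : k = 1 ∧ 0 ≤ B.eval a * A1.eval a := by
  have hk0 : (0 : ℝ) < k := by exact_mod_cast hk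
  have hp := Real.pi_pos
  have e1 := ks_angle A1 B a k h (Real.pi / (2 * k)) (by positivity) (by
    rw [div_lt_iff₀ (by positivity)]
    have : (1 : ℝ) ≤ k := by exact_mod_cast hk
    nlinarith)
  have : (k : ℝ) * (Real.pi / (2 * k)) = Real.pi / 2 := by field_simp
  rw [this, Real.sin_pi_div_two, mul_one] at e1
  refine ⟨?_, e1⟩
  by_contra hne
  have hk2 : (2 : ℝ) ≤ k := by
    have : 2 ≤ k := by omega
    exact_mod_cast this
  have e2 := ks_angle A1 B a k h (3 * Real.pi / (2 * k)) (by positivity) (by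
    rw [div_lt_iff₀ (by positivity)]
    nlinarith)
  have : (k : ℝ) * (3 * Real.pi / (2 * k)) = Real.pi / 2 + Real.pi := by field_simp; ring
  rw [this, Real.sin_add_pi, Real.sin_pi_div_two] at e2
  have : B.eval a * A1.eval a ≠ 0 := mul_ne_zero hB hA
  apply this
  linarith

open Polynomial ComplexConjugate in
lemma ks_splits (A : ℝ[X]) (h : ∀ t : ℂ, 0 < t.im → aeval t A ≠ 0) : A.Splits := by
  apply Splits.of_splits_map (algebraMap ℝ ℂ) (IsAlgClosed.splits _)
  intro z hz
  have hz0 : aeval z A = 0 := by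
    have := (mem_roots'.1 hz).2
    rwa [IsRoot.def, eval_map_algebraMap] at this
  have him : z.im = 0 := by
    rcases lt_trichotomy z.im 0 with h1 | h1 | h1
    · exfalso
      apply h (conj z) (by simpa using h1)
      rw [aeval_conj, hz0, map_zero]
    · exact h1
    · exact absurd hz0 (h z h1)
  exact ⟨z.re, Complex.ext (by simp) (by simp [him])⟩

open Polynomial ComplexConjugate in
lemma ks_partial (n : ℕ) : ∀ (A B : ℝ[X]), A.natDegree = n → B.degree < A.degree →
    (∀ t : ℝ, 0 ≤ t → 0 < A.eval t) →
    (∀ t : ℂ, 0 < t.im → ∀ s : ℂ, 0 ≤ s.im → aeval t A + s * aeval t B ≠ 0) →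
    ∃ (S : Finset ℝ) (c : ℝ → ℝ), (∀ a ∈ S, a < 0 ∧ 0 ≤ c a) ∧
      ∀ t : ℝ, 0 ≤ t → B.eval t / A.eval t = ∑ a ∈ S, c a * (t - a)⁻¹ := by
  induction n with
  | zero =>
    intro A B hn hd hA hst
    refine ⟨∅, fun _ => 0, by simp, ?_⟩
    have hA0 : A ≠ 0 := by
      rintro rfl
      simpa using hA 0 le_rfl
    have : B = 0 := by
      rw [degree_eq_natDegree hA0, hn] at hd
      by_contra hB
      rw [degree_eq_natDegree hB] at hd
      have : B.natDegree < 0 := by exact_mod_cast hd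
      omega
    simp [this]
  | succ n ih =>
    intro A B hn hd hA hst
    have hA0 : A ≠ 0 := by
      rintro rfl
      simpa using hA 0 le_rfl
    by_cases hc : ∃ a, A.eval a = 0 ∧ B.eval a = 0
    · obtain ⟨a, ha, hb⟩ := hc
      obtain ⟨A1, rfl⟩ := dvd_iff_isRoot.2 ha
      obtain ⟨B1, rfl⟩ := dvd_iff_isRoot.2 hb
      have hneg : a < 0 := by
        by_contra hcon
        exact (hA a (not_lt.1 hcon)).ne' ha
      have hA1 : A1 ≠ 0 := right_ne_zero_of_mul hA0
      have g1 : A1.natDegree = n := by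
        rw [natDegree_mul (X_sub_C_ne_zero a) hA1, natDegree_X_sub_C] at hn
        omega
      have g2 : B1.degree < A1.degree := by
        rw [degree_mul, degree_mul, degree_X_sub_C] at hd
        exact lt_of_add_lt_add_left hd
      have g3 : ∀ t : ℝ, 0 ≤ t → 0 < A1.eval t := by
        intro t ht
        have := hA t ht
        simp only [eval_mul, eval_sub, eval_X, eval_C] at this
        exact pos_of_mul_pos_right this (by linarith)
      obtain ⟨S, c, h1, h2⟩ := ih A1 B1 g1 g2 g3 (by
        intro t ht s hs hz
        apply hst t ht s hs
        rw [map_mul, map_mul]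
        linear_combination (aeval t (X - C a)) * hz)
      refine ⟨S, c, h1, fun t ht => ?_⟩
      rw [← h2 t ht]
      simp only [eval_mul, eval_sub, eval_X, eval_C]
      rw [mul_div_mul_left]
      have : 0 < t - a := by linarith
      exact this.ne'
    · push Not at hc
      have hspl : A.Splits := ks_splits A (fun t ht => by simpa using hst t ht 0 le_rfl)
      have hw : ∀ t : ℂ, 0 < t.im → (aeval t B * conj (aeval t A)).im ≤ 0 :=
        fun t ht => ks_im_le _ _ (hst t ht)
      have hroot : ∀ a ∈ A.roots, A.rootMultiplicity a = 1 ∧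
          0 ≤ B.eval a * (derivative A).eval a := by
        intro a ha
        have ha0 : A.eval a = 0 := (mem_roots'.1 ha).2
        obtain ⟨q, hq, hnd⟩ := exists_eq_pow_rootMultiplicity_mul_and_not_dvd A hA0 a
        have hk : 1 ≤ A.rootMultiplicity a := (rootMultiplicity_pos hA0).2 ha0
        have hqa : q.eval a ≠ 0 := fun h => hnd (dvd_iff_isRoot.2 h)
        have := ks_simple q B a (A.rootMultiplicity a) hk (by rw [← hq]; exact hw) hqa (hc a ha0)
        refine ⟨this.1, ?_⟩
        rw [this.1, pow_one] at hq
        rw [hq]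
        simpa using this.2
      classical
      have hnod : A.roots.Nodup := by
        rw [Multiset.nodup_iff_count_eq_one]
        intro a ha
        rw [count_roots]
        exact (hroot a ha).1
      set S := A.roots.toFinset with hS
      have hAn : A = C A.leadingCoeff * Lagrange.nodal S id := by
        conv_lhs => rw [hspl.eq_prod_roots]
        congr 1
        rw [Lagrange.nodal, Finset.prod, hS, Multiset.toFinset_val, hnod.dedup]
        rfl
      have hcard : B.degree < (S.card : WithBot ℕ) := by
        have : S.card = A.natDegree := by
          rw [hS, Multiset.toFinset_card_of_nodup hnod, hspl.natDegree_eq_card_roots]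
        rw [this, ← degree_eq_natDegree hA0]; exact hd
      have hl : A.leadingCoeff ≠ 0 := leadingCoeff_ne_zero.2 hA0
      refine ⟨S, fun a => Lagrange.nodalWeight S id a * B.eval a / A.leadingCoeff, ?_, ?_⟩
      · intro a ha
        have ha' : a ∈ A.roots := by simpa [hS] using ha
        have ha0 : A.eval a = 0 := (mem_roots'.1 ha').2
        refine ⟨by by_contra hcon; exact (hA a (not_lt.1 hcon)).ne' ha0, ?_⟩
        have h1 := (hroot a ha').2
        simp only
        rw [Lagrange.nodalWeight_eq_eval_derivative_nodal ha]
        have h2 : (derivative A).eval a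
            = A.leadingCoeff * (derivative (Lagrange.nodal S id)).eval a := by
          conv_lhs => rw [hAn]
          simp
        rw [h2] at h1
        simp only [id]
        set D := (derivative (Lagrange.nodal S id)).eval a
        have : D⁻¹ * B.eval a / A.leadingCoeff
          = (B.eval a * (A.leadingCoeff * D)) * (D⁻¹ * A.leadingCoeff⁻¹) ^ 2 := by
          by_cases hD : D = 0
          · simp [hD]
          · field_simp
        rw [this]
        positivity
      · intro t ht
        have hnt : ∀ i ∈ S, t ≠ id i := by
          intro i hi h
          have ha' : i ∈ A.roots := by simpa [hS] using hi
          have ha0 : A.eval i = 0 := (mem_roots'.1 ha').2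
          have := hA t ht
          rw [h] at this
          exact this.ne' ha0
        have h1 := Lagrange.eval_interpolate_not_at_node (fun i => B.eval (id i)) hnt
        rw [← Lagrange.eq_interpolate (Set.injOn_id _) hcard] at h1
        have h2 : A.eval t = A.leadingCoeff * (Lagrange.nodal S id).eval t := by
          conv_lhs => rw [hAn]
          simp
        have h3 : (Lagrange.nodal S id).eval t ≠ 0 := by
          intro h; rw [h, mul_zero] at h2; exact (hA t ht).ne' h2
        rw [h1, h2, mul_comm A.leadingCoeff, mul_div_mul_left _ _ h3, Finset.sum_div]
        apply Finset.sum_congr rfl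
        intro i hi
        simp only [id]
        ring

open Polynomial in
lemma ks_convex (A B : ℝ[X]) (hd : B.degree < A.degree)
    (hA : ∀ t : ℝ, 0 ≤ t → 0 < A.eval t)
    (hst : ∀ t : ℂ, 0 < t.im → ∀ s : ℂ, 0 ≤ s.im → aeval t A + s * aeval t B ≠ 0) :
    (∀ t : ℝ, 0 ≤ t → 0 ≤ B.eval t / A.eval t) ∧
    AntitoneOn (fun t => B.eval t / A.eval t) (Set.Ici 0) ∧
    ConvexOn ℝ (Set.Ici 0) (fun t => B.eval t / A.eval t) := by
  obtain ⟨S, c, h1, h2⟩ := ks_partial A.natDegree A B rfl hd hA hst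
  have hanti : ∀ a ∈ S, AntitoneOn (fun t : ℝ => (t - a)⁻¹) (Set.Ici 0) := by
    intro a ha s hs t ht hst
    simp only [Set.mem_Ici] at hs ht
    have := (h1 a ha).1
    exact inv_anti₀ (by linarith) (by linarith)
  have hconv : ∀ a ∈ S, ConvexOn ℝ (Set.Ici 0) (fun t : ℝ => (t - a)⁻¹) := by
    intro a ha
    have h := (convexOn_zpow (𝕜 := ℝ) (-1)).translate_right (-a)
    have h' := h.subset (s := Set.Ici 0) (by
      intro t ht
      have := (h1 a ha).1
      simp only [Set.mem_Ici] at ht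
      simp only [Set.mem_preimage, Set.mem_Ioi]
      linarith) (convex_Ici 0)
    refine h'.congr ?_
    intro t ht
    simp only [Function.comp, zpow_neg_one]
    congr 1; ring
  refine ⟨?_, ?_, ?_⟩
  · intro t ht
    rw [h2 t ht]
    refine Finset.sum_nonneg fun a ha => mul_nonneg (h1 a ha).2 (inv_nonneg.2 ?_)
    have := (h1 a ha).1
    linarith
  · intro s hs t ht hst
    simp only
    rw [h2 t ht, h2 s hs]
    exact Finset.sum_le_sum fun a ha =>
      mul_le_mul_of_nonneg_left (hanti a ha hs ht hst) (h1 a ha).2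
  · have : ConvexOn ℝ (Set.Ici 0) (fun t : ℝ => ∑ a ∈ S, c a * (t - a)⁻¹) := by
      refine ⟨convex_Ici 0, ?_⟩
      intro x hx y hy p q hp hq hpq
      simp only [smul_eq_mul]
      rw [Finset.mul_sum, Finset.mul_sum, ← Finset.sum_add_distrib]
      refine Finset.sum_le_sum fun a ha => ?_
      have := (hconv a ha).2 hx hy hp hq hpq
      simp only [smul_eq_mul] at this
      have := mul_le_mul_of_nonneg_left this (h1 a ha).2
      linarith
    exact this.congr fun t ht => (h2 t ht).symm
/-- Class of (functions given by) multiaffine stable polynomials used in the argument. -/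
structure KSGood {ι : Type*} [DecidableEq ι] (N : ℕ) (K : ℝ → (ι → ℝ) → ℝ)
    (F : ℂ → (ι → ℂ) → ℂ) : Prop where
  aff : ∀ y w k t, F y (w + t • Pi.single k 1)
    = F y w + t * (F y w - F y (w - Pi.single k 1))
  stab : ∀ y w, 0 < y.im → (∀ k, 0 ≤ (w k).im) → F y w ≠ 0
  poly : ∀ (y : ℝ) (w : ι → ℝ) (η : ℝ) (u : ι → ℝ), ∃ p : Polynomial ℝ,
    p.natDegree ≤ N ∧ p.coeff N = K η u ∧
    ∀ t : ℂ, F (y + η * t) (fun k => (w k : ℂ) + u k * t) = Polynomial.aeval t p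
  cont : Continuous (fun x : ℂ × (ι → ℂ) => F x.1 x.2)

/-- real restriction -/
def ksRe {ι : Type*} (F : ℂ → (ι → ℂ) → ℂ) (y : ℝ) (w : ι → ℝ) : ℝ :=
  (F y (fun k => (w k : ℂ))).re

/-- shift in the variable `k` -/
def ksShift {ι : Type*} [DecidableEq ι] (k : ι) (F : ℂ → (ι → ℂ) → ℂ) : ℂ → (ι → ℂ) → ℂ :=
  fun y w => F y (w - Pi.single k 1)

/-- average of shifts -/
def ksAvg {ι : Type*} [DecidableEq ι] (R : Finset ι) (F : ℂ → (ι → ℂ) → ℂ) : ℂ → (ι → ℂ) → ℂ :=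
  fun y w => (R.card : ℂ)⁻¹ * ∑ k ∈ R, F y (w - Pi.single k 1)

/-- barrier function -/
def ksPhi {ι : Type*} [DecidableEq ι] (F : ℂ → (ι → ℂ) → ℂ) (k : ι) (y : ℝ) (w : ι → ℝ) : ℝ :=
  1 - ksRe F y (w - Pi.single k 1) / ksRe F y w

/-- above the roots -/
def ksAR {ι : Type*} (F : ℂ → (ι → ℂ) → ℂ) (y : ℝ) (w : ι → ℝ) : Prop :=
  ∀ y' w', y ≤ y' → w ≤ w' → 0 < ksRe F y' w'

lemma ks_cast_single {ι : Type*} [DecidableEq ι] (w : ι → ℝ) (k : ι) :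
    (fun l => (((w - Pi.single k 1 : ι → ℝ) l : ℝ) : ℂ))
      = (fun l => (w l : ℂ)) - Pi.single k 1 := by
  funext l
  by_cases h : l = k
  · subst h; simp
  · simp [h]

lemma ks_cast_single_add {ι : Type*} [DecidableEq ι] (w : ι → ℝ) (k : ι) (t : ℝ) :
    (fun l => (((w + t • Pi.single k 1 : ι → ℝ) l : ℝ) : ℂ))
      = (fun l => (w l : ℂ)) + (t : ℂ) • Pi.single k 1 := by
  funext l
  by_cases h : l = k
  · subst h; simp
  · simp [h]

section KS
variable {ι : Type*} [DecidableEq ι] {N : ℕ} {K : ℝ → (ι → ℝ) → ℝ} {F : ℂ → (ι → ℂ) → ℂ}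

lemma KSGood.real (hF : KSGood N K F) (y : ℝ) (w : ι → ℝ) :
    F y (fun k => (w k : ℂ)) = (ksRe F y w : ℂ) := by
  obtain ⟨p, -, -, hp⟩ := hF.poly y w 0 0
  have h := hp ((0 : ℝ) : ℂ)
  simp only [Complex.ofReal_zero, mul_zero, add_zero] at h
  have h2 : Polynomial.aeval (0 : ℂ) p = ((p.eval 0 : ℝ) : ℂ) := by
    simpa using Polynomial.aeval_algebraMap_apply_eq_algebraMap_eval (A := ℂ) (0 : ℝ) p
  rw [ksRe, h, h2, Complex.ofReal_re]

lemma KSGood.aff_real (hF : KSGood N K F) (y : ℝ) (w : ι → ℝ) (k : ι) (t : ℝ) :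
    ksRe F y (w + t • Pi.single k 1)
      = ksRe F y w + t * (ksRe F y w - ksRe F y (w - Pi.single k 1)) := by
  have h := hF.aff y (fun l => (w l : ℂ)) k t
  rw [← ks_cast_single_add, ← ks_cast_single, hF.real, hF.real, hF.real] at h
  exact_mod_cast h

lemma KSGood.poly_real (hF : KSGood N K F) (y : ℝ) (w : ι → ℝ) (η : ℝ) (u : ι → ℝ) :
    ∃ p : Polynomial ℝ, p.natDegree ≤ N ∧ p.coeff N = K η u ∧
    (∀ t : ℂ, F (y + η * t) (fun k => (w k : ℂ) + u k * t) = Polynomial.aeval t p) ∧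
    (∀ t : ℝ, ksRe F (y + η * t) (w + t • u) = p.eval t) := by
  obtain ⟨p, h1, h2, hp⟩ := hF.poly y w η u
  refine ⟨p, h1, h2, hp, fun t => ?_⟩
  have h := hp t
  have h2 : Polynomial.aeval (t : ℂ) p = ((p.eval t : ℝ) : ℂ) :=
    Polynomial.aeval_algebraMap_apply_eq_algebraMap_eval (A := ℂ) t p
  rw [h2] at h
  have h3 : F ((y + η * t : ℝ) : ℂ) (fun k => (((w + t • u) k : ℝ) : ℂ)) = ((p.eval t : ℝ) : ℂ) := by
    rw [← h]
    congr 1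
    · push_cast; rfl
    · funext k; simp [mul_comm]
  rw [ksRe, h3, Complex.ofReal_re]

lemma KSGood.cont_real (hF : KSGood N K F) :
    Continuous (fun x : ℝ × (ι → ℝ) => ksRe F x.1 x.2) := by
  have : Continuous (fun x : ℝ × (ι → ℝ) => ((x.1 : ℂ), (fun k => (x.2 k : ℂ)))) := by fun_prop
  exact Complex.continuous_re.comp (hF.cont.comp this)

lemma KSGood.shift (hF : KSGood N K F) (k : ι) : KSGood N K (ksShift k F) where
  aff y w l t := by
    simp only [ksShift]
    have := hF.aff y (w - Pi.single k 1) l t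
    rw [show w + t • Pi.single l 1 - Pi.single k 1 = w - Pi.single k 1 + t • Pi.single l 1 by abel,
      this, sub_right_comm]
  stab y w hy hw := by
    refine hF.stab _ _ hy fun l => ?_
    by_cases h : l = k
    · subst h; simpa using hw l
    · simpa [h] using hw l
  poly y w η u := by
    obtain ⟨p, h1, h2, h3⟩ := hF.poly y (w - Pi.single k 1) η u
    refine ⟨p, h1, h2, fun t => ?_⟩
    rw [← h3 t, ksShift]
    congr 1
    funext l
    by_cases h : l = k
    · subst h; simp; ring
    · simp [h]
  cont := by
    have : Continuous (fun x : ℂ × (ι → ℂ) => (x.1, x.2 - Pi.single k 1)) := by fun_prop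
    exact hF.cont.comp this

open ComplexConjugate in
lemma KSGood.avg (hF : KSGood N K F) (R : Finset ι) (hR : R.Nonempty) :
    KSGood N K (ksAvg R F) where
  aff y w l t := by
    simp only [ksAvg]
    have h : ∀ k ∈ R, F y (w + t • Pi.single l 1 - Pi.single k 1)
        = F y (w - Pi.single k 1) + t * (F y (w - Pi.single k 1)
          - F y (w - Pi.single l 1 - Pi.single k 1)) := fun k _ => (hF.shift k).aff y w l t
    rw [Finset.sum_congr rfl h, Finset.sum_add_distrib, ← Finset.mul_sum, Finset.sum_sub_distrib]
    ring
  stab y w hy hw := by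
    have hne := hF.stab y w hy hw
    set a := F y w with ha
    have hb : ∀ k, (a - F y (w - Pi.single k 1)) = 0 ∨
        ((a - F y (w - Pi.single k 1)) * conj a).im < 0 := by
      intro k
      apply ks_im_lt
      intro s hs
      rw [ha, ← hF.aff]
      refine hF.stab _ _ hy fun l => ?_
      by_cases h : l = k
      · subst h; simpa using add_nonneg (hw l) hs
      · simpa [h] using hw l
    have hc : (R.card : ℂ) ≠ 0 := by exact_mod_cast hR.card_pos.ne'
    intro h0
    have hsum : ∑ k ∈ R, F y (w - Pi.single k 1) = 0 := by
      simpa [ksAvg, hc] using h0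
    have hs2 : ∑ k ∈ R, (a - F y (w - Pi.single k 1)) = R.card * a := by
      rw [Finset.sum_sub_distrib, hsum]; simp
    have hs3 : ∑ k ∈ R, ((a - F y (w - Pi.single k 1)) * conj a).im = 0 := by
      rw [← Complex.im_sum, ← Finset.sum_mul, hs2, mul_assoc, Complex.mul_conj]
      simp
    have hall : ∀ k ∈ R, ((a - F y (w - Pi.single k 1)) * conj a).im = 0 := by
      apply (Finset.sum_eq_zero_iff_of_nonpos _).1 hs3
      intro k _
      rcases hb k with h | h
      · simp [h]
      · exact h.le
    have : ∑ k ∈ R, (a - F y (w - Pi.single k 1)) = 0 := by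
      refine Finset.sum_eq_zero fun k hk => ?_
      rcases hb k with h | h
      · exact h
      · exact absurd (hall k hk) h.ne
    rw [hs2] at this
    exact (mul_ne_zero hc hne) this
  poly y w η u := by
    choose p h1 h2 h3 using fun k => (hF.shift k).poly y w η u
    refine ⟨Polynomial.C (R.card : ℝ)⁻¹ * ∑ k ∈ R, p k, ?_, ?_, fun t => ?_⟩
    · refine (Polynomial.natDegree_C_mul_le _ _).trans ?_
      exact Polynomial.natDegree_sum_le_of_forall_le _ _ fun k _ => h1 k
    · rw [Polynomial.coeff_C_mul, Polynomial.finsetSum_coeff, Finset.sum_congr rfl fun k _ => h2 k]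
      have hc : (R.card : ℝ) ≠ 0 := by exact_mod_cast hR.card_pos.ne'
      simp [hc]
    · rw [map_mul, map_sum, Finset.sum_congr rfl fun k _ => (h3 k t).symm]
      simp [ksAvg, ksShift]
  cont := by
    have := fun k => (hF.shift k).cont
    simp only [ksShift] at this
    simp only [ksAvg]
    exact continuous_const.mul (continuous_finsetSum _ fun k _ => this k)

lemma ks_re_shift (F : ℂ → (ι → ℂ) → ℂ) (k : ι) (y : ℝ) (w : ι → ℝ) :
    ksRe (ksShift k F) y w = ksRe F y (w - Pi.single k 1) := by
  rw [ksRe, ksRe, ksShift, ks_cast_single]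

lemma ks_re_avg (F : ℂ → (ι → ℂ) → ℂ) (R : Finset ι) (y : ℝ) (w : ι → ℝ) :
    ksRe (ksAvg R F) y w = (R.card : ℝ)⁻¹ * ∑ k ∈ R, ksRe F y (w - Pi.single k 1) := by
  simp only [ksRe, ksAvg, ks_cast_single]
  rw [← Complex.re_sum, ← Complex.re_ofReal_mul]
  simp

lemma ks_line (hF : KSGood N K F) (hK : ∀ η u, 0 < η → 0 ≤ u → 0 < K η u) (k : ι)
    (y : ℝ) (w : ι → ℝ) (η : ℝ) (u : ι → ℝ) (hη : 0 < η) (hu : 0 ≤ u)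
    (hpos : ∀ t : ℝ, 0 ≤ t → 0 < ksRe F (y + η * t) (w + t • u)) :
    (∀ t : ℝ, 0 ≤ t → 0 ≤ ksPhi F k (y + η * t) (w + t • u)) ∧
    AntitoneOn (fun t => ksPhi F k (y + η * t) (w + t • u)) (Set.Ici 0) ∧
    ConvexOn ℝ (Set.Ici 0) (fun t => ksPhi F k (y + η * t) (w + t • u)) := by
  obtain ⟨p, p1, p2, p3, p4⟩ := hF.poly_real y w η u
  obtain ⟨q, q1, q2, q3, q4⟩ := (hF.shift k).poly_real y w η u
  have hKp := hK η u hη hu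
  have hpd : p.degree = N := by
    refine le_antisymm (Polynomial.natDegree_le_iff_degree_le.1 p1) ?_
    exact Polynomial.le_degree_of_ne_zero (by rw [p2]; exact hKp.ne')
  have hd : (p - q).degree < p.degree := by
    rw [hpd, Polynomial.degree_lt_iff_coeff_zero]
    intro j hj
    rw [Polynomial.coeff_sub]
    rcases hj.eq_or_lt with rfl | hj
    · rw [p2, q2, sub_self]
    · rw [Polynomial.coeff_eq_zero_of_natDegree_lt (by omega),
        Polynomial.coeff_eq_zero_of_natDegree_lt (by omega), sub_self]
  have heq : ∀ t : ℝ, 0 ≤ t →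
      (p - q).eval t / p.eval t = ksPhi F k (y + η * t) (w + t • u) := by
    intro t ht
    have := hpos t ht
    rw [ksPhi, ← ks_re_shift, q4 t, p4 t, Polynomial.eval_sub, sub_div, div_self]
    rw [← p4 t]; exact this.ne'
  obtain ⟨c1, c2, c3⟩ := ks_convex p (p - q) hd (fun t ht => by rw [← p4 t]; exact hpos t ht) (by
    intro t ht s hs
    rw [map_sub, ← p3, ← q3]
    simp only [ksShift]
    rw [← hF.aff]
    apply hF.stab
    · simp; positivity
    · intro l
      have h1 : 0 ≤ u l * t.im := mul_nonneg (hu l) ht.le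
      by_cases h : l = k
      · subst h; simpa using add_nonneg h1 hs
      · simpa [h] using h1)
  refine ⟨fun t ht => by rw [← heq t ht]; exact c1 t ht, ?_, c3.congr fun t ht => heq t ht⟩
  intro s hs t ht hst
  have := c2 hs ht hst
  simp only at this ⊢
  rwa [heq t ht, heq s hs] at this

lemma ks_line0 (hF : KSGood N K F) (hK : ∀ η u, 0 < η → 0 ≤ u → 0 < K η u) (k : ι)
    (y : ℝ) (w : ι → ℝ) (hAR : ksAR F y w) (η : ℝ) (u : ι → ℝ) (hη : 0 ≤ η) (hu : 0 ≤ u) :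
    AntitoneOn (fun t => ksPhi F k (y + η * t) (w + t • u)) (Set.Ici 0) ∧
    ConvexOn ℝ (Set.Ici 0) (fun t => ksPhi F k (y + η * t) (w + t • u)) := by
  have hpos : ∀ η' : ℝ, 0 ≤ η' → ∀ t : ℝ, 0 ≤ t → 0 < ksRe F (y + η' * t) (w + t • u) := by
    intro η' h' t ht
    apply hAR
    · nlinarith [mul_nonneg h' ht]
    · intro l
      have : 0 ≤ t * u l := mul_nonneg ht (hu l)
      simpa using this
  have hlim : ∀ t : ℝ, 0 ≤ t → Filter.Tendsto (fun η' : ℝ => ksPhi F k (y + η' * t) (w + t • u))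
      (nhdsWithin η (Set.Ioi η)) (nhds (ksPhi F k (y + η * t) (w + t • u))) := by
    intro t ht
    have hc : ∀ w0 : ι → ℝ, Continuous fun η' : ℝ => ksRe F (y + η' * t) w0 := by
      intro w0
      have : Continuous (fun η' : ℝ => ((y + η' * t, w0) : ℝ × (ι → ℝ))) := by fun_prop
      exact hF.cont_real.comp this
    have : ContinuousAt (fun η' : ℝ => ksPhi F k (y + η' * t) (w + t • u)) η := by
      simp only [ksPhi]
      exact continuousAt_const.sub ((hc _).continuousAt.div (hc _).continuousAt (hpos η hη t ht).ne')
    exact this.tendsto.mono_left nhdsWithin_le_nhds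
  have hev : ∀ η' ∈ Set.Ioi η, 
    AntitoneOn (fun t => ksPhi F k (y + η' * t) (w + t • u)) (Set.Ici 0) ∧
    ConvexOn ℝ (Set.Ici 0) (fun t => ksPhi F k (y + η' * t) (w + t • u)) := by
    intro η' h'
    have h0 : 0 < η' := lt_of_le_of_lt hη h'
    exact (ks_line hF hK k y w η' u h0 hu (hpos η' h0.le)).2
  constructor
  · intro s hs t ht hst
    exact le_of_tendsto_of_tendsto (hlim t ht) (hlim s hs)
      (Filter.eventually_of_mem self_mem_nhdsWithin fun η' h' => (hev η' h').1 hs ht hst)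
  · refine ⟨convex_Ici 0, ?_⟩
    intro a ha b hb p q hp hq hpq
    have hab : p • a + q • b ∈ Set.Ici (0 : ℝ) := (convex_Ici 0) ha hb hp hq hpq
    exact le_of_tendsto_of_tendsto (hlim _ hab)
      (((hlim a ha).const_smul p).add ((hlim b hb).const_smul q))
      (Filter.eventually_of_mem self_mem_nhdsWithin fun η' h' => (hev η' h').2.2 ha hb hp hq hpq)

lemma ks_mono (hF : KSGood N K F) (hK : ∀ η u, 0 < η → 0 ≤ u → 0 < K η u) (k : ι)
    (y : ℝ) (w : ι → ℝ) (hAR : ksAR F y w) (y' : ℝ) (w' : ι → ℝ) (hy : y ≤ y') (hw : w ≤ w') :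
    ksPhi F k y' w' ≤ ksPhi F k y w := by
  have := (ks_line0 hF hK k y w hAR (y' - y) (w' - w) (by linarith) (sub_nonneg.2 hw)).1
    (Set.mem_Ici.2 (le_refl (0 : ℝ))) (Set.mem_Ici.2 (zero_le_one)) zero_le_one
  simpa using this

/-- indicator vector -/
def ksInd (R : Finset ι) : ι → ℝ := fun k => if k ∈ R then 1 else 0

lemma ks_deriv0 (hF : KSGood N K F) (y : ℝ) (R : Finset ι) : ∀ w : ι → ℝ,
    HasDerivAt (fun t : ℝ => ksRe F y (w + t • ksInd R))
      (∑ k ∈ R, (ksRe F y w - ksRe F y (w - Pi.single k 1))) 0 := by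
  induction R using Finset.induction_on with
  | empty =>
    intro w
    have : ksInd (∅ : Finset ι) = 0 := by funext k; simp [ksInd]
    simpa [this] using hasDerivAt_const (0 : ℝ) (ksRe F y w)
  | insert k R hk ih =>
    intro w
    have h1 := ih w
    have h2 := ih (w - Pi.single k 1)
    have h3 := h1.add ((hasDerivAt_id (0 : ℝ)).mul (h1.sub h2))
    have hfun : (fun t : ℝ => ksRe F y (w + t • ksInd (insert k R)))
        = (fun t : ℝ => ksRe F y (w + t • ksInd R)) +
          (id * ((fun t : ℝ => ksRe F y (w + t • ksInd R))
            - (fun t : ℝ => ksRe F y (w - Pi.single k 1 + t • ksInd R)))) := by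
      funext t
      have hi : ksInd (insert k R) = ksInd R + Pi.single k 1 := by
        funext l
        by_cases h : l = k
        · subst h; simp [ksInd, hk]
        · simp [ksInd, h]
      simp only [Pi.add_apply, Pi.mul_apply, Pi.sub_apply, id]
      rw [hi, smul_add, ← add_assoc, hF.aff_real]
      rw [show w + t • ksInd R - Pi.single k 1 = w - Pi.single k 1 + t • ksInd R by abel]
    rw [hfun]
    refine h3.congr_deriv ?_
    rw [Finset.sum_insert hk]
    simp
    ring

lemma ks_deriv (hF : KSGood N K F) (y : ℝ) (R : Finset ι) (w : ι → ℝ) (δ : ℝ) :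
    HasDerivAt (fun t : ℝ => ksRe F y (w + t • ksInd R))
      (∑ k ∈ R, (ksRe F y (w + δ • ksInd R) - ksRe F y (w + δ • ksInd R - Pi.single k 1))) δ := by
  have h := ks_deriv0 hF y R (w + δ • ksInd R)
  have h2 : HasDerivAt (fun t : ℝ => t - δ) 1 δ := (hasDerivAt_id δ).sub_const δ
  have h3 := HasDerivAt.comp (h := fun t : ℝ => t - δ) δ (by rw [sub_self]; exact h) h2
  rw [mul_one] at h3
  refine h3.congr_of_eventuallyEq (Filter.Eventually.of_forall fun t => ?_)
  simp only [Function.comp]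
  congr 1
  rw [sub_smul]
  abel

lemma ks_step (hF : KSGood N K F) (hK : ∀ η u, 0 < η → 0 ≤ u → 0 < K η u)
    (y : ℝ) (w : ι → ℝ) (hAR : ksAR F y w) (hphi : ∀ k, ksPhi F k y w ≤ 1 / 2)
    (R : Finset ι) (hR : R.Nonempty) :
    ksAR (ksAvg R F) y (w + (2 / (R.card : ℝ)) • ksInd R) ∧
    ∀ k, ksPhi (ksAvg R F) k y (w + (2 / (R.card : ℝ)) • ksInd R) ≤ 1 / 2 := by
  have hr : (0 : ℝ) < R.card := by exact_mod_cast hR.card_pos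
  set δ : ℝ := 2 / (R.card : ℝ) with hδ
  have hδ0 : 0 < δ := by positivity
  have hind : (0 : ι → ℝ) ≤ ksInd R := by
    intro k; simp only [ksInd]; split_ifs <;> simp
  have hw' : w ≤ w + δ • ksInd R := by
    intro k
    have := mul_nonneg hδ0.le (hind k)
    simpa using this
  have hhalf : ∀ y' w', y ≤ y' → w ≤ w' → ksRe F y' w' / 2 ≤ ksRe (ksAvg R F) y' w' := by
    intro y' w' hy hw
    have hp := hAR y' w' hy hw
    rw [ks_re_avg]
    have : ∀ k ∈ R, ksRe F y' w' / 2 ≤ ksRe F y' (w' - Pi.single k 1) := by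
      intro k _
      have h1 := (ks_mono hF hK k y w hAR y' w' hy hw).trans (hphi k)
      rw [ksPhi] at h1
      have h2 : 1 / 2 ≤ ksRe F y' (w' - Pi.single k 1) / ksRe F y' w' := by linarith
      rw [le_div_iff₀ hp] at h2
      linarith
    have := Finset.card_nsmul_le_sum _ _ _ this
    rw [nsmul_eq_mul] at this
    calc ksRe F y' w' / 2 = (R.card : ℝ)⁻¹ * (R.card * (ksRe F y' w' / 2)) := by field_simp
      _ ≤ _ := by gcongr
  refine ⟨fun y' w' hy hw => ?_, fun k => ?_⟩
  · have h1 := hhalf y' w' hy (hw'.trans hw)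
    have h2 := hAR y' w' hy (hw'.trans hw)
    linarith
  · refine le_trans ?_ (hphi k)
    obtain ⟨hanti, hconv⟩ := ks_line0 hF hK k y w hAR 0 (ksInd R) le_rfl hind
    simp only [zero_mul, add_zero] at hanti hconv
    have dA := ks_deriv hF y R w δ
    have dC := ks_deriv hF y R (w - Pi.single k 1) δ
    have hAv : ksRe (ksAvg R F) y (w + δ • ksInd R) = ksRe F y (w + δ • ksInd R)
      - (R.card : ℝ)⁻¹ * ∑ l ∈ R, (ksRe F y (w + δ • ksInd R)
          - ksRe F y (w + δ • ksInd R - Pi.single l 1)) := by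
      rw [ks_re_avg, Finset.sum_sub_distrib, Finset.sum_const, nsmul_eq_mul]
      field_simp
      ring
    have hcomm : ∀ t : ℝ, w + t • ksInd R - Pi.single k 1 = w - Pi.single k 1 + t • ksInd R := by
      intro t; abel
    have hCv : ksRe (ksAvg R F) y (w + δ • ksInd R - Pi.single k 1)
      = ksRe F y (w - Pi.single k 1 + δ • ksInd R)
      - (R.card : ℝ)⁻¹ * ∑ l ∈ R, (ksRe F y (w - Pi.single k 1 + δ • ksInd R)
          - ksRe F y (w - Pi.single k 1 + δ • ksInd R - Pi.single l 1)) := by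
      rw [ks_re_avg, Finset.sum_sub_distrib, Finset.sum_const, nsmul_eq_mul, hcomm]
      field_simp
      ring
    have hApos := hAR y _ le_rfl hw'
    have hh := hhalf y _ le_rfl hw'
    rw [ksPhi, hCv, hAv]
    rw [hAv] at hh
    set A' := ∑ l ∈ R, (ksRe F y (w + δ • ksInd R) - ksRe F y (w + δ • ksInd R - Pi.single l 1))
    set C' := ∑ l ∈ R, (ksRe F y (w - Pi.single k 1 + δ • ksInd R)
          - ksRe F y (w - Pi.single k 1 + δ • ksInd R - Pi.single l 1))
    have dh := (dC.div dA hApos.ne').const_sub 1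
    have hfun : (fun t : ℝ => ksPhi F k y (w + t • ksInd R)) =
      fun t => 1 - ((fun t : ℝ => ksRe F y (w - Pi.single k 1 + t • ksInd R)) /
        (fun t : ℝ => ksRe F y (w + t • ksInd R))) t := by
      funext t
      simp only [ksPhi, hcomm, Pi.div_apply]
    rw [← hfun] at dh
    have s1 := hconv.slope_le_of_hasDerivAt (x := 0) (y := δ) (by simp) (by simp [hδ0.le]) hδ0 dh
    have s2 := hconv.le_slope_of_hasDerivAt (x := δ) (y := δ + 1) (by simp [hδ0.le])
      (by simp; linarith) (by linarith) dh
    have s3 := hanti (a := δ) (b := δ + 1) (by simp [hδ0.le])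
      (by simp; linarith) (by linarith)
    simp only at s3
    rw [slope_def_field] at s1 s2
    rw [div_le_iff₀ (by linarith)] at s1
    have s2' : -((C' * ksRe F y (w + δ • ksInd R)
      - ksRe F y (w - Pi.single k 1 + δ • ksInd R) * A') / ksRe F y (w + δ • ksInd R) ^ 2) ≤ 0 := by
      refine s2.trans ?_
      rw [add_sub_cancel_left, div_one]
      linarith
    simp only [zero_smul, add_zero] at s1
    have e1 : ksPhi F k y (w + δ • ksInd R) = 1 - ksRe F y (w - Pi.single k 1 + δ • ksInd R)
      / ksRe F y (w + δ • ksInd R) := by rw [ksPhi, hcomm]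
    rw [e1] at s1
    set A := ksRe F y (w + δ • ksInd R)
    set C := ksRe F y (w - Pi.single k 1 + δ • ksInd R)
    set g' := (C' * A - C * A') / A ^ 2 with hg'
    set h0 := ksPhi F k y w
    have hden : 0 < A - (R.card : ℝ)⁻¹ * A' := by linarith
    have e2 : C - (R.card : ℝ)⁻¹ * C' = C / A * (A - (R.card : ℝ)⁻¹ * A')
        - g' * A * (R.card : ℝ)⁻¹ := by
      rw [hg']; field_simp; ring
    have hg0 : 0 ≤ g' := by linarith
    have e3 : g' * A * (R.card : ℝ)⁻¹ ≤ (δ * g') * (A - (R.card : ℝ)⁻¹ * A') := by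
      have : g' * A * (R.card : ℝ)⁻¹ = (δ * g') * (A / 2) := by rw [hδ]; field_simp
      rw [this]
      exact mul_le_mul_of_nonneg_left hh (by positivity)
    have e4 : C / A - δ * g' ≤ (C - (R.card : ℝ)⁻¹ * C') / (A - (R.card : ℝ)⁻¹ * A') := by
      rw [le_div_iff₀ hden, e2]
      linarith
    linarith

/-- iterated averages -/
def ksIter {κ : Type*} (R : κ → Finset ι) (F : ℂ → (ι → ℂ) → ℂ) : List κ → ℂ → (ι → ℂ) → ℂ
  | [] => F
  | i :: L => ksAvg (R i) (ksIter R F L)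

lemma ks_iter_good {κ : Type*} (R : κ → Finset ι) (hR : ∀ i, (R i).Nonempty)
    (hF : KSGood N K F) (L : List κ) : KSGood N K (ksIter R F L) := by
  induction L with
  | nil => exact hF
  | cons i L ih => exact ih.avg (R i) (hR i)

lemma ks_iter_shift {κ : Type*} (R : κ → Finset ι) (k : ι) (L : List κ) :
    ksIter R (ksShift k F) L = ksShift k (ksIter R F L) := by
  induction L with
  | nil => rfl
  | cons i L ih =>
    simp only [ksIter, ih]
    funext y w
    simp only [ksAvg, ksShift]
    congr 1
    exact Finset.sum_congr rfl fun l _ => by rw [sub_right_comm]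

lemma ks_barrier {κ : Type*} (R : κ → Finset ι) (hR : ∀ i, (R i).Nonempty)
    (hF : KSGood N K F) (hK : ∀ η u, 0 < η → 0 ≤ u → 0 < K η u)
    (y : ℝ) (w : ι → ℝ) (hAR : ksAR F y w) (hphi : ∀ k, ksPhi F k y w ≤ 1 / 2) (L : List κ) :
    ksAR (ksIter R F L) y (w + (L.map fun i => (2 / ((R i).card : ℝ)) • ksInd (R i)).sum) ∧
    ∀ k, ksPhi (ksIter R F L) k y
      (w + (L.map fun i => (2 / ((R i).card : ℝ)) • ksInd (R i)).sum) ≤ 1 / 2 := by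
  induction L with
  | nil => simpa [ksIter] using And.intro hAR (by simpa using hphi)
  | cons i L ih =>
    have := ks_step (ks_iter_good R hR hF L) hK y _ ih.1 ih.2 (R i) (hR i)
    rw [List.map_cons, List.sum_cons, add_comm (_ • _) (List.sum _), ← add_assoc]
    exact this

lemma ks_eventually_pos (hF : KSGood N K F) (hK : ∀ η u, 0 < η → 0 ≤ u → 0 < K η u)
    (w : ι → ℝ) : ∃ y0 : ℝ, ∀ y, y0 ≤ y → 0 < ksRe F y w := by
  obtain ⟨p, p1, p2, p3, p4⟩ := hF.poly_real 0 w 1 0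
  have hKp := hK 1 0 one_pos le_rfl
  have hnd : p.natDegree = N :=
    le_antisymm p1 (Polynomial.le_natDegree_of_ne_zero (by rw [p2]; exact hKp.ne'))
  have hlc : 0 < p.leadingCoeff := by rw [Polynomial.leadingCoeff, hnd, p2]; exact hKp
  have heq : ∀ y, ksRe F y w = p.eval y := by
    intro y; rw [← p4 y]; simp
  have hev : ∀ᶠ y in Filter.atTop, 0 < p.eval y := by
    by_cases h0 : 0 < p.degree
    · exact (Polynomial.tendsto_atTop_of_leadingCoeff_nonneg p h0 hlc.le).eventually_gt_atTop 0
    · have hc := Polynomial.eq_C_of_degree_le_zero (not_lt.1 h0)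
      refine Filter.Eventually.of_forall fun y => ?_
      rw [hc] at hlc ⊢
      simpa using hlc
  obtain ⟨y0, h⟩ := Filter.eventually_atTop.1 hev
  exact ⟨y0, fun y hy => by rw [heq]; exact h y hy⟩

lemma ks_select_pos (hF : KSGood N K F) (hK : ∀ η u, 0 < η → 0 ≤ u → 0 < K η u)
    (α : ℝ) (w : ι → ℝ) (R : Finset ι) (hR : R.Nonempty)
    (h : ∀ y, α ≤ y → 0 < ksRe (ksAvg R F) y w) : ∀ y, α ≤ y → 0 < ksRe F y w := by
  have hc : ∀ w0 : ι → ℝ, Continuous fun y : ℝ => ksRe F y w0 := fun w0 =>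
    hF.cont_real.comp (by fun_prop : Continuous fun y : ℝ => ((y, w0) : ℝ × (ι → ℝ)))
  by_contra hcon
  push Not at hcon
  obtain ⟨y1, hy1, hy1'⟩ := hcon
  obtain ⟨y0, hy0⟩ := ks_eventually_pos hF hK w
  let Z : Set ℝ := {y | ksRe F y w ≤ 0} ∩ Set.Icc α y0
  have hZc : IsCompact Z :=
    isCompact_Icc.inter_left (isClosed_le (hc w) continuous_const)
  have hZn : Z.Nonempty := ⟨y1, hy1', hy1, by
    by_contra hlt
    exact absurd (hy0 y1 (not_le.1 hlt).le) (not_lt.2 hy1')⟩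
  obtain ⟨M, hM, hMax⟩ := hZc.exists_isGreatest hZn
  have hbig : ∀ y, M < y → 0 < ksRe F y w := by
    intro y hy
    by_contra hle
    have hle' := not_lt.1 hle
    have : y ∈ Z := ⟨hle', hM.2.1.trans hy.le, by
      by_contra hlt
      exact absurd (hy0 y (not_le.1 hlt).le) hle⟩
    exact absurd (hMax this) (not_le.2 hy)
  have hB : ∀ k, ∀ y, M < y → ksRe F y (w - Pi.single k 1) ≤ ksRe F y w := by
    intro k y hy
    have := (ks_line hF hK k y w 1 0 one_pos le_rfl (fun t ht => by
      simpa using hbig (y + t) (by linarith))).1 0 le_rfl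
    simp only [mul_zero, add_zero, zero_smul, ksPhi] at this
    have h2 : ksRe F y (w - Pi.single k 1) / ksRe F y w ≤ 1 := by linarith
    rwa [div_le_one (hbig y hy)] at h2
  have hBM : ∀ k, ksRe F M (w - Pi.single k 1) ≤ ksRe F M w := by
    intro k
    exact le_of_tendsto_of_tendsto
      ((hc _).continuousAt.tendsto.mono_left nhdsWithin_le_nhds)
      ((hc _).continuousAt.tendsto.mono_left nhdsWithin_le_nhds)
      (Filter.eventually_of_mem (self_mem_nhdsWithin : Set.Ioi M ∈ nhdsWithin M (Set.Ioi M))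
        (hB k))
  have hlast := h M hM.2.1
  rw [ks_re_avg] at hlast
  have hr : (0 : ℝ) < R.card := by exact_mod_cast hR.card_pos
  have : ∑ k ∈ R, ksRe F M (w - Pi.single k 1) ≤ 0 :=
    Finset.sum_nonpos fun k _ => (hBM k).trans hM.1
  have := mul_nonpos_of_nonneg_of_nonpos (inv_nonneg.2 hr.le) this
  linarith

lemma ks_select_step (hF : KSGood N K F) (hK : ∀ η u, 0 < η → 0 ≤ u → 0 < K η u)
    (α : ℝ) (w : ι → ℝ) (R : Finset ι) (hR : R.Nonempty)
    (h : ∀ y, α ≤ y → 0 < ksRe (ksAvg R F) y w) :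
    ∃ k ∈ R, ∀ y, α ≤ y → 0 < ksRe (ksShift k F) y w := by
  have hpos := ks_select_pos hF hK α w R hR h
  have h0 := h α le_rfl
  rw [ks_re_avg] at h0
  have hr : (0 : ℝ) < R.card := by exact_mod_cast hR.card_pos
  have hs : 0 < ∑ k ∈ R, ksRe F α (w - Pi.single k 1) := by
    by_contra hle
    exact absurd h0 (not_lt.2 (mul_nonpos_of_nonneg_of_nonpos (inv_nonneg.2 hr.le) (not_lt.1 hle)))
  obtain ⟨k, hk, hk0⟩ := Finset.exists_lt_of_sum_lt (s := R) (f := fun _ => (0 : ℝ)) (by simpa using hs)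
  refine ⟨k, hk, fun y hy => ?_⟩
  rw [ks_re_shift]
  have hanti := (ks_line hF hK k α w 1 0 one_pos le_rfl (fun t ht => by
      simpa using hpos (α + t) (by linarith))).2.1 (Set.mem_Ici.2 (le_refl (0 : ℝ)))
      (Set.mem_Ici.2 (sub_nonneg.2 hy)) (sub_nonneg.2 hy)
  simp only [mul_zero, add_zero, smul_zero, one_mul, ksPhi, add_sub_cancel] at hanti
  have h1 : 0 < ksRe F α (w - Pi.single k 1) / ksRe F α w := div_pos hk0 (hpos α le_rfl)
  have h2 : 0 < ksRe F y (w - Pi.single k 1) / ksRe F y w := by linarith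
  exact (div_pos_iff_of_pos_right (hpos y hy)).1 h2

lemma ks_select {κ : Type*} [DecidableEq κ] [Nonempty ι]
    (R : κ → Finset ι) (hR : ∀ i, (R i).Nonempty)
    (hK : ∀ η u, 0 < η → 0 ≤ u → 0 < K η u) (α : ℝ) (L : List κ) (hL : L.Nodup) :
    ∀ (F : ℂ → (ι → ℂ) → ℂ) (_ : KSGood N K F) (w : ι → ℝ),
    (∀ y, α ≤ y → 0 < ksRe (ksIter R F L) y w) →
    ∃ c : κ → ι, (∀ i ∈ L, c i ∈ R i) ∧
      ∀ y, α ≤ y → 0 < ksRe F y (w - (L.map fun i => Pi.single (c i) (1 : ℝ)).sum) := by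
  induction L with
  | nil =>
    intro F _ w h
    exact ⟨fun _ => Classical.arbitrary ι, by simp, by simpa [ksIter] using h⟩
  | cons i L ih =>
    intro F hF w h
    rw [List.nodup_cons] at hL
    obtain ⟨k, hk, h1⟩ := ks_select_step (ks_iter_good R hR hF L) hK α w (R i) (hR i) h
    rw [← ks_iter_shift] at h1
    obtain ⟨c, c1, c2⟩ := ih hL.2 _ (hF.shift k) w h1
    refine ⟨Function.update c i k, ?_, ?_⟩
    · intro j hj
      by_cases hji : j = i
      · subst hji; simpa using hk
      · rw [Function.update_of_ne hji]
        exact c1 j (by simpa [hji] using hj)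
    · intro y hy
      have := c2 y hy
      rw [ks_re_shift] at this
      have e : (L.map fun j => (Pi.single (Function.update c i k j) 1 : ι → ℝ))
          = L.map fun j => Pi.single (c j) 1 := by
        apply List.map_congr_left
        intro j hj
        rw [Function.update_of_ne]
        rintro rfl
        exact hL.1 hj
      rw [List.map_cons, List.sum_cons, e, Function.update_self,
        add_comm (Pi.single k 1), ← sub_sub]
      exact this
end KS
/-- the complex matrix pencil -/
def ksMat {m d : ℕ} (v : Fin m → Fin d → ℝ) (y : ℂ) (x : Fin m → ℂ) : Matrix (Fin d) (Fin d) ℂ :=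
  y • 1 + ∑ i, x i • Matrix.vecMulVec (fun a => (v i a : ℂ)) (fun a => (v i a : ℂ))

/-- the real matrix pencil -/
def ksMatR {m d : ℕ} (v : Fin m → Fin d → ℝ) (y : ℝ) (x : Fin m → ℝ) :
    Matrix (Fin d) (Fin d) ℝ :=
  y • 1 + ∑ i, x i • Matrix.vecMulVec (v i) (v i)

/-- the base polynomial -/
def ksBase {m d : ℕ} (r : ℕ) (v : Fin m → Fin d → ℝ) (y : ℂ) (w : Fin m × Fin r → ℂ) : ℂ :=
  ∏ j, (ksMat v y fun i => w (i, j)).det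

/-- the leading coefficient -/
def ksLead {m d : ℕ} (r : ℕ) (v : Fin m → Fin d → ℝ) (y : ℝ) (w : Fin m × Fin r → ℝ) : ℝ :=
  ∏ j, (ksMatR v y fun i => w (i, j)).det

lemma ks_det_affine {d : ℕ} (A : Matrix (Fin d) (Fin d) ℂ) (v : Fin d → ℂ) :
    ∃ b : ℂ, ∀ t : ℂ, (A + t • Matrix.vecMulVec v v).det = A.det + t * b := by
  let P : Matrix (Fin d ⊕ Unit) (Fin d ⊕ Unit) ℂ :=
    Matrix.fromBlocks A (Matrix.replicateCol Unit (-v)) 0 1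
  let e0 : Fin d ⊕ Unit → ℂ := Sum.elim (fun _ => 0) (fun _ => 1)
  let e1 : Fin d ⊕ Unit → ℂ := Sum.elim v (fun _ => 0)
  have key : ∀ t : ℂ, (A + t • Matrix.vecMulVec v v).det
      = (P.updateRow (Sum.inr ()) (e0 + t • e1)).det := by
    intro t
    have h1 : P.updateRow (Sum.inr ()) (e0 + t • e1)
        = Matrix.fromBlocks A (Matrix.replicateCol Unit (-v))
          (Matrix.replicateRow Unit (t • v)) 1 := by
      ext i j
      rcases i with i | i <;> rcases j with j | j <;> simp [P, e0, e1, Matrix.updateRow_apply]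
    rw [h1, Matrix.det_fromBlocks_one₂₂]
    congr 1
    ext i j
    simp only [Matrix.mul_apply, Matrix.vecMulVec_apply, Matrix.add_apply, Matrix.sub_apply,
      Matrix.smul_apply, Matrix.replicateCol_apply, Matrix.replicateRow_apply, Pi.neg_apply,
      Pi.smul_apply, smul_eq_mul, Finset.univ_unique, Finset.sum_singleton]
    ring
  refine ⟨(P.updateRow (Sum.inr ()) e1).det, fun t => ?_⟩
  have h0 := key 0
  rw [zero_smul, add_zero, zero_smul, add_zero] at h0
  rw [key, Matrix.det_updateRow_add, Matrix.det_updateRow_smul, ← h0]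

lemma ks_det_ne {m d : ℕ} (v : Fin m → Fin d → ℝ) (y : ℂ) (x : Fin m → ℂ) (hy : 0 < y.im)
    (hx : ∀ i, 0 ≤ (x i).im) : (ksMat v y x).det ≠ 0 := by
  intro h
  obtain ⟨z, hz, hz0⟩ := Matrix.exists_mulVec_eq_zero_iff.2 h
  have h1 : star z ⬝ᵥ (ksMat v y x).mulVec z = y * ((∑ a, Complex.normSq (z a) : ℝ) : ℂ)
      + ∑ i, x i * ((Complex.normSq (∑ a, (v i a : ℂ) * z a) : ℝ) : ℂ) := by
    rw [ksMat, Matrix.add_mulVec, dotProduct_add, Matrix.sum_mulVec, dotProduct_sum]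
    congr 1
    · rw [Matrix.smul_mulVec, Matrix.one_mulVec, dotProduct_smul, smul_eq_mul]
      congr 1
      simp only [dotProduct, Pi.star_apply]
      push_cast
      refine Finset.sum_congr rfl fun a _ => ?_
      rw [Complex.normSq_eq_conj_mul_self]; rfl
    · refine Finset.sum_congr rfl fun i _ => ?_
      rw [Matrix.smul_mulVec, dotProduct_smul, smul_eq_mul, Matrix.vecMulVec_mulVec]
      congr 1
      rw [Complex.normSq_eq_conj_mul_self, dotProduct_smul]
      simp only [dotProduct, Pi.star_apply, map_sum, map_mul, Complex.conj_ofReal, MulOpposite.smul_eq_mul_unop, MulOpposite.unop_op]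
      congr 1
      refine Finset.sum_congr rfl fun a _ => ?_
      exact mul_comm _ _
  rw [hz0, dotProduct_zero] at h1
  have h2 := congrArg Complex.im h1
  rw [Complex.add_im, Complex.im_mul_ofReal, Complex.im_sum] at h2
  simp only [Complex.im_mul_ofReal, Complex.zero_im] at h2
  have h3 : 0 < ∑ a, Complex.normSq (z a) := by
    obtain ⟨a, ha⟩ := Function.ne_iff.1 hz
    exact Finset.sum_pos' (fun _ _ => Complex.normSq_nonneg _)
      ⟨a, Finset.mem_univ _, Complex.normSq_pos.2 ha⟩
  have h4 : 0 ≤ ∑ i, (x i).im * Complex.normSq (∑ a, (v i a : ℂ) * z a) :=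
    Finset.sum_nonneg fun i _ => mul_nonneg (hx i) (Complex.normSq_nonneg _)
  have := mul_pos hy h3
  linarith

lemma ks_posdef {m d : ℕ} (v : Fin m → Fin d → ℝ) (y : ℝ) (x : Fin m → ℝ) (hy : 0 < y)
    (hx : ∀ i, 0 ≤ x i) : 0 < (ksMatR v y x).det := by
  apply Matrix.PosDef.det_pos
  apply Matrix.PosDef.add_posSemidef
  · exact Matrix.PosDef.one.smul hy
  · refine Matrix.posSemidef_sum _ fun i _ => ?_
    have : (Matrix.vecMulVec (v i) (v i)).PosSemidef := by
      simpa using Matrix.posSemidef_vecMulVec_self_star (v i)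
    exact this.smul (hx i)

lemma ks_base_poly {m d : ℕ} (r : ℕ) (v : Fin m → Fin d → ℝ) (y : ℝ) (w : Fin m × Fin r → ℝ)
    (η : ℝ) (u : Fin m × Fin r → ℝ) : ∃ p : Polynomial ℝ,
    p.natDegree ≤ r * d ∧ p.coeff (r * d) = ksLead r v η u ∧
    ∀ t : ℂ, ksBase r v (y + η * t) (fun k => (w k : ℂ) + u k * t) = Polynomial.aeval t p := by
  let f : Fin r → Polynomial ℝ := fun j =>
    ((Polynomial.X : Polynomial ℝ) • (ksMatR v η fun i => u (i, j)).map Polynomial.C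
      + (ksMatR v y fun i => w (i, j)).map Polynomial.C).det
  have hf : ∀ j, (f j).natDegree ≤ d := fun j => by
    simpa using Polynomial.natDegree_det_X_add_C_le (ksMatR v η fun i => u (i, j))
      (ksMatR v y fun i => w (i, j))
  refine ⟨∏ j, f j, ?_, ?_, fun t => ?_⟩
  · refine (Polynomial.natDegree_prod_le _ _).trans ?_
    refine (Finset.sum_le_card_nsmul _ _ d fun j _ => hf j).trans ?_
    simp
  · have := Polynomial.coeff_prod_of_natDegree_le Finset.univ f d fun j _ => hf j
    rw [Finset.card_univ, Fintype.card_fin] at this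
    rw [this, ksLead]
    refine Finset.prod_congr rfl fun j _ => ?_
    simpa using Polynomial.coeff_det_X_add_C_card (ksMatR v η fun i => u (i, j))
      (ksMatR v y fun i => w (i, j))
  · rw [map_prod, ksBase]
    refine Finset.prod_congr rfl fun j _ => ?_
    simp only [f]
    rw [AlgHom.map_det]
    congr 1
    ext a b
    simp only [ksMat, ksMatR, Matrix.add_apply, Matrix.smul_apply, Matrix.sum_apply,
      AlgHom.mapMatrix_apply, Matrix.map_apply, smul_eq_mul, map_add, map_mul, map_sum,
      Polynomial.aeval_X, Polynomial.aeval_C, Complex.coe_algebraMap, Matrix.vecMulVec_apply,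
      Complex.ofReal_add, Complex.ofReal_mul, Complex.ofReal_sum]
    rw [Finset.sum_congr rfl fun i _ => add_mul ((w (i, j) : ℂ)) (u (i, j) * t) _,
      Finset.sum_add_distrib, mul_add, Finset.mul_sum]
    have h1 : (((1 : Matrix (Fin d) (Fin d) ℝ) a b : ℝ) : ℂ) = (1 : Matrix (Fin d) (Fin d) ℂ) a b := by
      by_cases h : a = b
      · subst h; simp
      · simp [h]
    rw [h1, Finset.sum_congr rfl fun i _ => show (u (i, j) : ℂ) * t * ((v i a : ℂ) * v i b)
      = t * (u (i, j) * (v i a * v i b)) by ring]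
    ring

lemma ks_base_good {m d : ℕ} (r : ℕ) (v : Fin m → Fin d → ℝ) :
    KSGood (r * d) (ksLead r v) (ksBase (m := m) r v) where
  aff y w k t := by
    obtain ⟨i0, j0⟩ := k
    obtain ⟨b, hb⟩ := ks_det_affine (ksMat v y fun i => w (i, j0)) (fun a => (v i0 a : ℂ))
    have key : ∀ t : ℂ, ksBase r v y (w + t • Pi.single (i0, j0) 1)
        = ((ksMat v y fun i => w (i, j0)).det + t * b) *
          ∏ j ∈ Finset.univ.erase j0, (ksMat v y fun i => w (i, j)).det := by
      intro t
      rw [ksBase, ← Finset.mul_prod_erase _ _ (Finset.mem_univ j0), ← hb]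
      congr 1
      · congr 1
        simp only [ksMat, Pi.add_apply, Pi.smul_apply, add_smul, Finset.sum_add_distrib]
        rw [add_assoc]
        congr 2
        rw [Finset.sum_eq_single i0]
        · simp
        · intro i _ hi
          simp [hi]
        · simp
      · refine Finset.prod_congr rfl fun j hj => ?_
        congr 2
        funext i
        have : j ≠ j0 := Finset.ne_of_mem_erase hj
        simp [this]
    have k0 := key 0
    have k1 := key (-1)
    rw [zero_smul, add_zero] at k0
    rw [neg_one_smul, ← sub_eq_add_neg] at k1
    rw [key, k0, k1]
    ring
  stab y w hy hw := by
    refine Finset.prod_ne_zero_iff.2 fun j _ => ?_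
    exact ks_det_ne v y _ hy fun i => hw _
  poly := ks_base_poly r v
  cont := by
    unfold ksBase
    refine continuous_finsetProd _ fun j _ => ?_
    refine Continuous.matrix_det ?_
    unfold ksMat
    fun_prop

lemma ks_base_re {m d : ℕ} (r : ℕ) (v : Fin m → Fin d → ℝ) (y : ℝ) (w : Fin m × Fin r → ℝ) :
    ksRe (ksBase r v) y w = ∏ j, (ksMatR v y fun i => w (i, j)).det := by
  have : ksBase r v y (fun k => (w k : ℂ))
      = ((∏ j, (ksMatR v y fun i => w (i, j)).det : ℝ) : ℂ) := by
    rw [ksBase, Complex.ofReal_prod]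
    refine Finset.prod_congr rfl fun j _ => ?_
    have h0 := RingHom.map_det Complex.ofRealHom (ksMatR v y fun i => w (i, j))
    rw [Complex.ofRealHom_eq_coe] at h0
    rw [h0]
    congr 1
    ext a b
    have h1 : (((1 : Matrix (Fin d) (Fin d) ℝ) a b : ℝ) : ℂ) = (1 : Matrix (Fin d) (Fin d) ℂ) a b := by
      by_cases h : a = b
      · subst h; simp
      · simp [h]
    simp [ksMat, ksMatR, Matrix.sum_apply, Matrix.vecMulVec_apply, h1]
  rw [ksRe, this, Complex.ofReal_re]

lemma ks_matR_shift {m d : ℕ} (v : Fin m → Fin d → ℝ)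
    (hiso : ∑ i : Fin m, Matrix.vecMulVec (v i) (v i) = (1 : Matrix (Fin d) (Fin d) ℝ))
    (y : ℝ) (x : Fin m → ℝ) (δ : ℝ) :
    ksMatR v y x = ksMatR v (y - δ) (fun i => x i + δ) := by
  simp only [ksMatR, add_smul, Finset.sum_add_distrib, ← Finset.smul_sum, hiso, sub_smul]
  abel

lemma ks_det_rank_one {d : ℕ} (t : ℝ) (ht : t ≠ 0) (v : Fin d → ℝ) :
    (t • (1 : Matrix (Fin d) (Fin d) ℝ) - Matrix.vecMulVec v v).det
      = (t • (1 : Matrix (Fin d) (Fin d) ℝ)).det * (1 - (∑ a, v a ^ 2) / t) := by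
  have h : t • (1 : Matrix (Fin d) (Fin d) ℝ) - Matrix.vecMulVec v v
      = (t • (1 : Matrix (Fin d) (Fin d) ℝ)) *
        (1 + Matrix.replicateCol Unit (-(t⁻¹ • v)) * Matrix.replicateRow Unit v) := by
    ext a b
    simp [Matrix.mul_apply, Matrix.vecMulVec_apply, Matrix.one_apply]
    split_ifs <;> field_simp <;> ring
  rw [h, Matrix.det_mul, Matrix.det_one_add_replicateCol_mul_replicateRow]
  congr 1
  simp only [dotProduct, Pi.neg_apply, Pi.smul_apply, smul_eq_mul, Finset.sum_div]
  rw [sub_eq_add_neg, ← Finset.sum_neg_distrib]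
  congr 1
  refine Finset.sum_congr rfl fun a _ => ?_
  field_simp

lemma ks_start {m d : ℕ} (v : Fin m → Fin d → ℝ) (ε : ℝ)
    (hiso : ∑ i : Fin m, Matrix.vecMulVec (v i) (v i) = (1 : Matrix (Fin d) (Fin d) ℝ))
    (hnorm : ∀ i, ∑ j, v i j ^ 2 ≤ ε) (r : ℕ) (t δ : ℝ) (ht : 0 < t) (hε : 2 * ε ≤ t) :
    ksAR (ksBase r v) (t + δ) (fun _ => -δ) ∧
    ∀ k, ksPhi (ksBase r v) k (t + δ) (fun _ => -δ) ≤ 1 / 2 := by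
  constructor
  · intro y w hy hw
    rw [ks_base_re]
    refine Finset.prod_pos fun j _ => ?_
    rw [ks_matR_shift v hiso _ _ δ]
    refine ks_posdef v _ _ (by linarith) fun i => ?_
    have := hw (i, j)
    simp only at this
    linarith
  · rintro ⟨i0, j0⟩
    rw [ksPhi, ks_base_re, ks_base_re, ← Finset.mul_prod_erase _ _ (Finset.mem_univ j0),
      ← Finset.mul_prod_erase _ _ (Finset.mem_univ j0)]
    have h1 : ∀ j ∈ Finset.univ.erase j0,
        (ksMatR v (t + δ) fun i => ((fun _ => -δ) - Pi.single (i0, j0) 1 : Fin m × Fin r → ℝ) (i, j)).det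
        = (ksMatR v (t + δ) fun i => -δ).det := by
      intro j hj
      have : j ≠ j0 := Finset.ne_of_mem_erase hj
      congr 2
      funext i
      simp [this]
    rw [Finset.prod_congr rfl h1]
    have h2 : ksMatR v (t + δ) (fun _ => -δ) = t • (1 : Matrix (Fin d) (Fin d) ℝ) := by
      rw [ks_matR_shift v hiso _ _ δ]
      simp [ksMatR]
    have h3 : (ksMatR v (t + δ) fun i =>
          ((fun _ => -δ) - Pi.single (i0, j0) 1 : Fin m × Fin r → ℝ) (i, j0))
        = t • (1 : Matrix (Fin d) (Fin d) ℝ) - Matrix.vecMulVec (v i0) (v i0) := by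
      rw [← h2]
      simp only [ksMatR, Pi.sub_apply, sub_smul, Finset.sum_sub_distrib]
      rw [add_sub_assoc]
      congr 2
      rw [Finset.sum_eq_single i0]
      · simp
      · intro i _ hi
        simp [hi]
      · simp
    have h4 : (t • (1 : Matrix (Fin d) (Fin d) ℝ)).det ≠ 0 := by
      rw [Matrix.det_smul]; simp [ht.ne']
    rw [h3, h2, ks_det_rank_one t ht.ne']
    have h5 : (∏ j ∈ Finset.univ.erase j0, (t • (1 : Matrix (Fin d) (Fin d) ℝ)).det) ≠ 0 :=
      Finset.prod_ne_zero_iff.2 fun _ _ => h4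
    rw [mul_div_mul_right _ _ h5, mul_div_cancel_left₀ _ h4, sub_sub_cancel, div_le_iff₀ ht]
    have := hnorm i0
    linarith

lemma ks_psd {d : ℕ} (M : Matrix (Fin d) (Fin d) ℝ) (hM : M.IsHermitian) (α β : ℝ) (hαβ : α ≤ β)
    (h : ∀ y, α ≤ y → (y • (1 : Matrix (Fin d) (Fin d) ℝ) - M).det ≠ 0) :
    (β • (1 : Matrix (Fin d) (Fin d) ℝ) - M).PosSemidef := by
  have hH : (β • (1 : Matrix (Fin d) (Fin d) ℝ) - M).IsHermitian :=
    Matrix.IsHermitian.sub (by ext a b; simp [Matrix.one_apply, eq_comm]) hM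
  rw [hH.posSemidef_iff_eigenvalues_nonneg]
  intro i
  by_contra hneg
  simp only [Pi.zero_apply, not_le] at hneg
  apply h (β - hH.eigenvalues i) (by linarith)
  rw [← Matrix.exists_mulVec_eq_zero_iff]
  refine ⟨(hH.eigenvectorBasis i).ofLp, ?_, ?_⟩
  · intro h0
    apply hH.eigenvectorBasis.orthonormal.ne_zero i
    ext a
    simpa using congrFun h0 a
  · have := hH.mulVec_eigenvectorBasis i
    rw [sub_smul, sub_right_comm, Matrix.sub_mulVec, this, Matrix.smul_mulVec, Matrix.one_mulVec,
      sub_self]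

lemma ks_main {m d : ℕ} (v : Fin m → Fin d → ℝ) (ε : ℝ)
    (hiso : ∑ i : Fin m, Matrix.vecMulVec (v i) (v i) = (1 : Matrix (Fin d) (Fin d) ℝ))
    (hnorm : ∀ i, ∑ j, v i j ^ 2 ≤ ε) (r : ℕ) (hr : 0 < r) (hm : 0 < m) (hε : 0 ≤ ε) :
    ∃ c : Fin m → Fin r, ∀ j : Fin r,
      Matrix.PosSemidef
          ((4 * (1 / (r : ℝ) + ε) + 2 * (1 / (r : ℝ) + ε) ^ 2) •
              (1 : Matrix (Fin d) (Fin d) ℝ)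
            - ∑ i ∈ Finset.univ.filter (fun i => c i = j), Matrix.vecMulVec (v i) (v i)) := by
  have hr0 : (0 : ℝ) < r := by exact_mod_cast hr
  haveI : Nonempty (Fin m × Fin r) := ⟨(⟨0, hm⟩, ⟨0, hr⟩)⟩
  have hK : ∀ (η : ℝ) (u : Fin m × Fin r → ℝ), 0 < η → 0 ≤ u → 0 < ksLead r v η u := by
    intro η u hη hu
    exact Finset.prod_pos fun j _ => ks_posdef v _ _ hη fun i => hu (i, j)
  let R : Fin m → Finset (Fin m × Fin r) := fun i => {i} ×ˢ Finset.univ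
  have hcard : ∀ i, (R i).card = r := fun i => by simp [R]
  have hR : ∀ i, (R i).Nonempty := fun i => by
    rw [← Finset.card_pos, hcard]; exact hr
  have hGood := ks_base_good r v
  obtain ⟨s1, s2⟩ := ks_start v ε hiso hnorm r (2 / r + 2 * ε) (2 / r) (by positivity)
    (by have : 0 < 2 / (r : ℝ) := by positivity
        linarith)
  obtain ⟨b1, -⟩ := ks_barrier R hR hGood hK _ _ s1 s2 (List.finRange m)
  have hw : ((fun _ => -(2 / (r : ℝ))) : Fin m × Fin r → ℝ)
      + ((List.finRange m).map fun i => (2 / ((R i).card : ℝ)) • ksInd (R i)).sum = 0 := by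
    rw [← List.ofFn_eq_map, List.sum_ofFn]
    funext ⟨i, j⟩
    simp [hcard, ksInd, R, Finset.sum_apply]
  rw [hw] at b1
  obtain ⟨c, c1, c2⟩ := ks_select R hR hK (2 / r + 2 * ε + 2 / r) (List.finRange m)
    (List.nodup_finRange m) _ hGood 0 (fun y hy => b1 y 0 hy le_rfl)
  refine ⟨fun i => (c i).2, fun j => ?_⟩
  refine ks_psd _ ?_ (2 / r + 2 * ε + 2 / r) _ ?_ ?_
  · have hps : (∑ i ∈ Finset.univ.filter (fun i => (c i).2 = j),
        Matrix.vecMulVec (v i) (v i)).PosSemidef :=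
      Matrix.posSemidef_sum _ fun i _ => by
        simpa using Matrix.posSemidef_vecMulVec_self_star (v i)
    exact hps.isHermitian
  · have : (0 : ℝ) ≤ 2 * (1 / (r : ℝ) + ε) ^ 2 := by positivity
    have e : (2 : ℝ) / r = 2 * (1 / r) := by ring
    rw [e]
    linarith
  · intro y hy
    have h1 := c2 y hy
    rw [ks_base_re] at h1
    have h2 := Finset.prod_ne_zero_iff.1 h1.ne' j (Finset.mem_univ j)
    convert h2 using 2
    rw [ksMatR, sub_eq_add_neg, Finset.sum_filter, ← Finset.sum_neg_distrib]
    congr 1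
    refine Finset.sum_congr rfl fun i _ => ?_
    have h3 : (0 - ((List.finRange m).map fun i => Pi.single (c i) (1 : ℝ)).sum :
        Fin m × Fin r → ℝ) (i, j) = if (c i).2 = j then -1 else 0 := by
      rw [← List.ofFn_eq_map, List.sum_ofFn, zero_sub, Pi.neg_apply, Finset.sum_apply,
        Finset.sum_eq_single i]
      · have hc : (c i).1 = i := by
          have := c1 i (List.mem_finRange i)
          exact Finset.mem_singleton.1 (Finset.mem_product.1 this).1
        by_cases h : (c i).2 = j
        · have : c i = (i, j) := Prod.ext hc h
          simp [this]
        · have : (i, j) ≠ c i := fun h' => h (by rw [← h'])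
          simp [h, this]
      · intro i' _ hi'
        have hc : (c i').1 = i' := by
          have := c1 i' (List.mem_finRange i')
          exact Finset.mem_singleton.1 (Finset.mem_product.1 this).1
        have : (i, j) ≠ c i' := fun h' => hi' (by rw [← hc, ← h'])
        simp [this]
      · simp
    rw [h3]
    split_ifs <;> simp

/-- If `Σ v_i v_iᵀ = I` and `‖v_i‖² ≤ ε`, then for every positive integer `r` there is a
partition of `[m]` into `S_1,...,S_r` with
`Σ_{i∈S_j} v_i v_iᵀ ⪯ (4(1/r + ε) + 2(1/r + ε)²)·I` for every `j`. -/
theorem stmt1 {m d : ℕ} (v : Fin m → Fin d → ℝ) (ε : ℝ)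
    (hiso : ∑ i : Fin m, Matrix.vecMulVec (v i) (v i) = (1 : Matrix (Fin d) (Fin d) ℝ))
    (hnorm : ∀ i, ∑ j, v i j ^ 2 ≤ ε)
    (r : ℕ) (hr : 0 < r) :
    ∃ S : Fin r → Finset (Fin m),
      (∀ a b : Fin r, a ≠ b → Disjoint (S a) (S b)) ∧
      (Finset.univ.biUnion S = (Finset.univ : Finset (Fin m))) ∧
      ∀ j : Fin r,
        Matrix.PosSemidef
          ((4 * (1 / (r : ℝ) + ε) + 2 * (1 / (r : ℝ) + ε) ^ 2) •
              (1 : Matrix (Fin d) (Fin d) ℝ)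
            - ∑ i ∈ S j, Matrix.vecMulVec (v i) (v i)) := by
  have hex : ∃ c : Fin m → Fin r, ∀ j : Fin r,
      Matrix.PosSemidef
          ((4 * (1 / (r : ℝ) + ε) + 2 * (1 / (r : ℝ) + ε) ^ 2) •
              (1 : Matrix (Fin d) (Fin d) ℝ)
            - ∑ i ∈ Finset.univ.filter (fun i => c i = j), Matrix.vecMulVec (v i) (v i)) := by
    rcases Nat.eq_zero_or_pos d with hd | hd
    · subst hd
      refine ⟨fun _ => ⟨0, hr⟩, fun j => ?_⟩
      rw [Subsingleton.elim (_ - _) (0 : Matrix (Fin 0) (Fin 0) ℝ)]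
      exact Matrix.PosSemidef.zero
    · have hm : 0 < m := by
        rcases Nat.eq_zero_or_pos m with hm | hm
        · subst hm
          have := congrFun (congrFun hiso ⟨0, hd⟩) ⟨0, hd⟩
          simp at this
        · exact hm
      have hε : 0 ≤ ε :=
        (Finset.sum_nonneg fun j _ => sq_nonneg (v ⟨0, hm⟩ j)).trans (hnorm ⟨0, hm⟩)
      exact ks_main v ε hiso hnorm r hr hm hε
  obtain ⟨c, hc⟩ := hex
  refine ⟨fun j => Finset.univ.filter (fun i => c i = j), ?_, ?_, hc⟩
  · intro a b hab
    rw [Finset.disjoint_left]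
    intro i hi hi'
    simp only [Finset.mem_filter, Finset.mem_univ, true_and] at hi hi'
    exact hab (hi.symm.trans hi')
  · ext i
    simp
end
end
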